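/- arXiv:0911.4003 — 2 statements merged into one kernel-verified Lean document; each statement's English description precedes it below -/
import Mathlib

section
/- Let Ω=(D,A,B,w) be a countable loose bipartite weighted web and b ∈ B with w(b) > 0. Then there exists ε > 0 such that the web obtained from Ω by decreasing the weight of b by ε is unhindered. -/
open scoped ENNReal NNReal Classical

/-- A network: a loopless digraph with edge set `E` on vertex type `V`,
capacity function `c`, source `s` (no in-edges) and sink `t` (no out-edges). -/
structure Network (V : Type) where
  E : Set (V × V)
  loopless : ∀ v, (v, v) ∉ E
  c : V × V → ℝ≥0
  s : V
  t : V
  ne : s ≠ t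
  no_in_s : ∀ v, (v, s) ∉ E
  no_out_t : ∀ v, (t, v) ∉ E

variable {V : Type}

/-- Out-degree of `f` at `x`: sum of `f` over edges leaving `x`. -/
noncomputable def dplus (f : V × V → ℝ≥0) (x : V) : ℝ≥0∞ := ∑' v, (f (x, v) : ℝ≥0∞)

/-- In-degree of `f` at `x`: sum of `f` over edges entering `x`. -/
noncomputable def dminus (f : V × V → ℝ≥0) (x : V) : ℝ≥0∞ := ∑' v, (f (v, x) : ℝ≥0∞)

/-- A flow: nonnegative, supported on the edges, below capacity, Kirchhoff away from s,t. -/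
structure IsFlow (N : Network V) (f : V × V → ℝ≥0) : Prop where
  supp : ∀ e, e ∉ N.E → f e = 0
  cap : ∀ e, f e ≤ N.c e
  kirchhoff : ∀ x, x ≠ N.s → x ≠ N.t → dplus f x = dminus f x

noncomputable def flowValue (N : Network V) (f : V × V → ℝ≥0) : ℝ≥0∞ := dplus f N.s

/-- An s–t cut, given by its vertex side `S`. -/
def IsCut (N : Network V) (S : Set V) : Prop := N.s ∈ S ∧ N.t ∉ S

/-- The edges of the cut `E(S, V∖S)`. -/
def cutEdges (N : Network V) (S : Set V) : Set (V × V) := {e ∈ N.E | e.1 ∈ S ∧ e.2 ∉ S}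

noncomputable def cutCap (N : Network V) (S : Set V) : ℝ≥0∞ :=
  ∑' e : cutEdges N S, (N.c e : ℝ≥0∞)

noncomputable def cutFlow (N : Network V) (f : V × V → ℝ≥0) (S : Set V) : ℝ≥0∞ :=
  ∑' e : cutEdges N S, (f e : ℝ≥0∞)

/-- `f` saturates the cut `E(S,V∖S)` and vanishes on the reverse cut `E(V∖S,S)`. -/
def Orthogonal (N : Network V) (f : V × V → ℝ≥0) (S : Set V) : Prop :=
  (∀ e ∈ cutEdges N S, f e = N.c e) ∧ (∀ e ∈ cutEdges N Sᶜ, f e = 0)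

/-- A weighted web. -/
structure Web (V : Type) where
  D : Set (V × V)
  A : Set V
  B : Set V
  w : V → ℝ≥0

def IsWalk (E : Set (V × V)) (p : List V) : Prop := p.Chain' (fun a b => (a, b) ∈ E)

/-- A (finite, directed) path/walk from `A` to `B` in the digraph with edge set `E`. -/
def IsABPath (E : Set (V × V)) (A B : Set V) (p : List V) : Prop :=
  IsWalk E p ∧ (∃ a ∈ A, p.head? = some a) ∧ (∃ b ∈ B, p.getLast? = some b)

/-- `S` is `A`–`B`-separating in the web `W`. -/
def Separates (W : Web V) (S : Set V) : Prop :=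
  ∀ p : List V, IsABPath W.D W.A W.B p → ∃ x ∈ S, x ∈ p

/-- A current in a weighted web. -/
structure IsCurrent (W : Web V) (f : V × V → ℝ≥0) : Prop where
  supp : ∀ e, e ∉ W.D → f e = 0
  out_le : ∀ x, dplus f x ≤ (W.w x : ℝ≥0∞)
  in_le : ∀ x, dminus f x ≤ (W.w x : ℝ≥0∞)
  flow_ineq : ∀ x, x ∉ W.A → dplus f x ≤ dminus f x
  a_in : ∀ a ∈ W.A, dminus f a = 0
  b_out : ∀ b ∈ W.B, dplus f b = 0

def SAT (W : Web V) (f : V × V → ℝ≥0) : Set V :=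
  {x | x ∈ W.A ∨ dminus f x = (W.w x : ℝ≥0∞)}

def SINK (f : V × V → ℝ≥0) : Set V := {x | dplus f x = 0}

def TER (W : Web V) (f : V × V → ℝ≥0) : Set V := SAT W f ∩ SINK f

/-- The set of vertices separated ("roofed") from `B` by `S`. -/
def RF (W : Web V) (S : Set V) : Set V :=
  {v | ∀ p : List V, IsABPath W.D {v} W.B p → ∃ x ∈ S, x ∈ p}

/-- The essential vertices of `S`: those `x ∈ S` not separated from `B` by `S∖{x}`. -/
def Essential (W : Web V) (S : Set V) : Set V :=
  {x ∈ S | ∃ p : List V, IsABPath W.D {x} W.B p ∧ ∀ y ∈ p, y ∈ S → y = x}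

def RFo (W : Web V) (S : Set V) : Set V := RF W S \ Essential W S

/-- A wave: a current whose terminal set separates, sending no flow outside `RF(TER f)`. -/
def IsWave (W : Web V) (f : V × V → ℝ≥0) : Prop :=
  IsCurrent W f ∧ Separates W (TER W f) ∧ ∀ x, x ∉ RF W (TER W f) → dplus f x = 0

def Bipartite (W : Web V) : Prop :=
  (∀ v : V, v ∈ W.A ∪ W.B) ∧ ∀ e ∈ W.D, e.1 ∈ W.A ∧ e.2 ∈ W.B

def IsHindrance (W : Web V) (f : V × V → ℝ≥0) : Prop :=
  IsWave W f ∧ ∃ a ∈ W.A, a ∉ Essential W (TER W f) ∧ dplus f a < (W.w a : ℝ≥0∞)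

def Hindered (W : Web V) : Prop := ∃ f, IsHindrance W f

def Loose (W : Web V) : Prop :=
  (∀ f, IsWave W f → ∀ e, f e = 0) ∧ ¬ IsHindrance W (fun _ => 0)

/-- A web-flow: a current satisfying Kirchhoff's law outside `A ∪ B`. -/
def IsWebFlow (W : Web V) (f : V × V → ℝ≥0) : Prop :=
  IsCurrent W f ∧ ∀ x, x ∉ W.A ∪ W.B → dplus f x = dminus f x

/-- The quotient web `Γ/f`. -/
def quotWeb (W : Web V) (f : V × V → ℝ≥0) : Web V where
  D := {e ∈ W.D | e.1 ∉ RFo W (TER W f) ∧ e.2 ∉ RFo W (TER W f)}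
  A := Essential W (TER W f)
  B := W.B
  w := W.w

/-- `f ↷ g`: `f` plus the restriction of `g` to the edges of `Γ/f`. -/
noncomputable def hetz (W : Web V) (f g : V × V → ℝ≥0) : V × V → ℝ≥0 :=
  fun e => f e + if e ∈ (quotWeb W f).D then g e else 0

/-- The residual network `RES(Δ,f)`. -/
noncomputable def resNetwork (N : Network V) (f : V × V → ℝ≥0) : Network V where
  E := N.E ∪ {e | (e.2, e.1) ∈ N.E ∧ e.2 ≠ N.s ∧ e.1 ≠ N.t}
  loopless := fun v hv => hv.elim (N.loopless v) (fun h => N.loopless v h.1)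
  c := fun e => if e ∈ N.E then N.c e - f e else f (e.2, e.1)
  s := N.s
  t := N.t
  ne := N.ne
  no_in_s := fun v hv => hv.elim (N.no_in_s v) (fun h => h.2.1 rfl)
  no_out_t := fun v hv => hv.elim (N.no_out_t v) (fun h => h.2.2 rfl)

/-- `f ⊕ g`, for `g` a flow in the residual network. -/
noncomputable def oplus (N : Network V) (f g : V × V → ℝ≥0) : V × V → ℝ≥0 :=
  fun e => if e ∈ N.E then f e + g e - g (e.2, e.1) else 0

/-- A finite directed s–t path. -/
def IsSTPath (N : Network V) (p : List V) : Prop :=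
  IsWalk N.E p ∧ p.head? = some N.s ∧ p.getLast? = some N.t ∧ p.Nodup

/-- A mundane flow: a nonnegative combination of (characteristic functions of) s–t paths. -/
def IsMundane (N : Network V) (f : V × V → ℝ≥0) : Prop :=
  ∃ (ι : Type) (θ : ι → ℝ≥0) (P : ι → List V),
    (∀ i, 0 < θ i) ∧ (∀ i, IsSTPath N (P i)) ∧
    ∀ e : V × V, (f e : ℝ≥0∞) = ∑' i, if e ∈ (P i).zip (P i).tail then (θ i : ℝ≥0∞) else 0

def NetLocallyFinite (N : Network V) : Prop :=
  ∀ v : V, {e ∈ N.E | e.1 = v ∨ e.2 = v}.Finite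

/-- A finite-cut-respecting flow. -/
def IsFCR (N : Network V) (f : V × V → ℝ≥0) : Prop :=
  IsFlow N f ∧ ∀ S : Set V, N.s ∈ S → (cutEdges N S).Finite →
    (N.t ∈ S → cutFlow N f S = cutFlow N f Sᶜ) ∧
    (N.t ∉ S → cutFlow N f S = cutFlow N f Sᶜ + flowValue N f)

/-- A cut-respecting flow. -/
def IsCR (N : Network V) (f : V × V → ℝ≥0) : Prop :=
  IsFCR N f ∧ ∀ S : Set V, IsCut N S →
    flowValue N f + cutFlow N f Sᶜ ≤ cutCap N S ∧
    cutFlow N f S ≤ cutCap N Sᶜ + flowValue N f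


/-- Total outflow of `c` at `v`. -/
noncomputable def outflow {N : Type} (c : N → N → ℝ) (v : N) : ℝ := ∑' t, c v t

/-- Total inflow of `c` at `v`. -/
noncomputable def inflow {N : Type} (c : N → N → ℝ) (v : N) : ℝ := ∑' u, c u v

theorem continuousOn_outflow {N : Type} {d : N → N → ℝ} (hout : ∀ u, Summable (d u)) (v : N) :
    ContinuousOn (fun c : N → N → ℝ => outflow c v) (Set.Icc 0 d) := by
  refine continuousOn_tsum (u := d v) (fun t => ?_) (hout v) ?_
  · exact (by fun_prop : Continuous fun c : N → N → ℝ => c v t).continuousOn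
  · intro t c hc
    rw [Real.norm_of_nonneg (hc.1 v t)]
    exact hc.2 v t

theorem continuousOn_inflow {N : Type} {d : N → N → ℝ} (hin : ∀ v, Summable fun u => d u v)
    (v : N) : ContinuousOn (fun c : N → N → ℝ => inflow c v) (Set.Icc 0 d) := by
  refine continuousOn_tsum (u := fun u => d u v) (fun t => ?_) (hin v) ?_
  · exact (by fun_prop : Continuous fun c : N → N → ℝ => c t v).continuousOn
  · intro t c hc
    rw [Real.norm_of_nonneg (hc.1 t v)]
    exact hc.2 t v

theorem summable_out_of_mem_Icc {N : Type} {d c : N → N → ℝ} (hout : ∀ u, Summable (d u))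
    (hc : c ∈ Set.Icc 0 d) (u : N) : Summable (c u) :=
  Summable.of_nonneg_of_le (hc.1 u) (hc.2 u) (hout u)

theorem summable_in_of_mem_Icc {N : Type} {d c : N → N → ℝ} (hin : ∀ v, Summable fun u => d u v)
    (hc : c ∈ Set.Icc 0 d) (v : N) : Summable fun u => c u v :=
  Summable.of_nonneg_of_le (fun u => hc.1 u v) (fun u => hc.2 u v) (hin v)

/-- A unit flow along a walk in the support of `c`, dominated by a multiple of `c`. -/
theorem exists_walk_flow {N : Type} {c : N → N → ℝ} (hc : 0 ≤ c)
    (hout : ∀ u, Summable (c u)) (hin : ∀ v, Summable fun u => c u v) {v w : N}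
    (h : Relation.TransGen (fun u t => 0 < c u t) v w) :
    ∃ (e : N → N → ℝ) (K : ℝ), 0 < K ∧ 0 ≤ e ∧ e ≤ K • c ∧ 1 ≤ outflow e v ∧
      ∀ z, outflow e z + (if z = w then 1 else 0) = inflow e z + (if z = v then 1 else 0) := by
  have single : ∀ a t, 0 < c a t → ∃ (e : N → N → ℝ) (K : ℝ), 0 < K ∧ 0 ≤ e ∧ e ≤ K • c ∧
      (∀ z, outflow e z = if z = a then 1 else 0) ∧
      (∀ z, inflow e z = if z = t then 1 else 0) := by
    intro a t hat
    refine ⟨fun p q => if p = a ∧ q = t then 1 else 0, (c a t)⁻¹, inv_pos.2 hat, ?_, ?_, ?_, ?_⟩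
    · intro p q
      dsimp
      split_ifs <;> norm_num
    · intro p q
      dsimp
      split_ifs with hpq
      · rw [hpq.1, hpq.2, inv_mul_cancel₀ hat.ne']
      · exact mul_nonneg (inv_pos.2 hat).le (hc p q)
    · intro z
      by_cases hz : z = a <;> simp [outflow, hz, tsum_ite_eq]
    · intro z
      by_cases hz : z = t <;> simp [inflow, hz, tsum_ite_eq]
  induction h with
  | single hat =>
    obtain ⟨e, K, hK, he, heK, ho, hi⟩ := single _ _ hat
    refine ⟨e, K, hK, he, heK, by simp [ho], fun z => ?_⟩
    rw [ho, hi, add_comm]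
  | @tail t w _ htw ih =>
    obtain ⟨e, K, hK, he, heK, ho, hi⟩ := ih
    obtain ⟨e', K', hK', he', heK', ho', hi'⟩ := single _ _ htw
    have s1 : ∀ z, Summable (e z) := fun z =>
      Summable.of_nonneg_of_le (he z) (heK z) ((hout z).mul_left K)
    have s2 : ∀ z, Summable (e' z) := fun z =>
      Summable.of_nonneg_of_le (he' z) (heK' z) ((hout z).mul_left K')
    have s3 : ∀ z, Summable fun u => e u z := fun z =>
      Summable.of_nonneg_of_le (fun u => he u z) (fun u => heK u z) ((hin z).mul_left K)
    have s4 : ∀ z, Summable fun u => e' u z := fun z =>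
      Summable.of_nonneg_of_le (fun u => he' u z) (fun u => heK' u z) ((hin z).mul_left K')
    have o : ∀ z, outflow (e + e') z = outflow e z + outflow e' z := fun z =>
      (s1 z).tsum_add (s2 z)
    have i : ∀ z, inflow (e + e') z = inflow e z + inflow e' z := fun z =>
      (s3 z).tsum_add (s4 z)
    refine ⟨e + e', K + K', by positivity, add_nonneg he he', ?_, ?_, fun z => ?_⟩
    · rw [add_smul]; exact add_le_add heK heK'
    · rw [o, ho']
      split_ifs <;> linarith
    · have := hi z
      rw [o, i, ho', hi']
      linarith

theorem exists_thin_subflow_on_finset {N : Type} {d : N → N → ℝ} (hd : 0 ≤ d)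
    (hout : ∀ u, Summable (d u)) (hin : ∀ v, Summable fun u => d u v) {b : N} {σ : N → ℝ}
    (hσ : ∀ v, v ≠ b → 0 ≤ σ v) (hb : σ b < 0) (hfeas : ∀ v, outflow d v ≤ inflow d v + σ v)
    (U : Finset N) :
    ∃ c ∈ Set.Icc 0 d, ∀ v ∈ U, outflow c v ≤ inflow c v + σ v ∧
      inflow c v ≤ outflow c v - min (σ v) 0 ∧ outflow c v ≤ - σ b := by
  have key : ∃ c ∈ {c ∈ Set.Icc 0 d | ∀ v ∈ U, outflow c v ≤ inflow c v + σ v},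
      IsMinOn (fun c => ∑ v ∈ U, (outflow c v + inflow c v))
        {c ∈ Set.Icc 0 d | ∀ v ∈ U, outflow c v ≤ inflow c v + σ v} c := by
    apply IsCompact.exists_isMinOn
    · have : {c ∈ Set.Icc 0 d | ∀ v ∈ U, outflow c v ≤ inflow c v + σ v} =
          Set.Icc 0 d ∩ ⋂ v ∈ U, {c ∈ Set.Icc 0 d | outflow c v ≤ inflow c v + σ v} := by
        ext c; simp +contextual
      rw [this]
      refine isCompact_Icc.inter_right (isClosed_biInter fun v _ => ?_)
      exact isClosed_Icc.isClosed_le (continuousOn_outflow hout v)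
        ((continuousOn_inflow hin v).add continuousOn_const)
    · exact ⟨d, ⟨hd, le_rfl⟩, fun v _ => hfeas v⟩
    · refine continuousOn_finsetSum _ fun v _ => ?_
      exact ((continuousOn_outflow hout v).add (continuousOn_inflow hin v)).mono fun c hc => hc.1
  obtain ⟨c, ⟨hcd, hcU⟩, hmin⟩ := key
  have hc0 : 0 ≤ c := hcd.1
  have so := summable_out_of_mem_Icc hout hcd
  have si := summable_in_of_mem_Icc hin hcd
  -- removing a subflow `e` without destroying feasibility is impossible
  have pert : ∀ e : N → N → ℝ, 0 ≤ e → e ≤ c →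
      (∀ v ∈ U, outflow c v - outflow e v ≤ inflow c v - inflow e v + σ v) →
      ∀ v ∈ U, outflow e v ≤ 0 ∧ inflow e v ≤ 0 := by
    intro e he hec hfe
    have eo := summable_out_of_mem_Icc so ⟨he, hec⟩
    have ei := summable_in_of_mem_Icc si ⟨he, hec⟩
    have o : ∀ z, outflow (c - e) z = outflow c z - outflow e z := fun z =>
      (so z).tsum_sub (eo z)
    have i : ∀ z, inflow (c - e) z = inflow c z - inflow e z := fun z =>
      (si z).tsum_sub (ei z)
    have hm : ∑ v ∈ U, (outflow c v + inflow c v) ≤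
        ∑ v ∈ U, (outflow (c - e) v + inflow (c - e) v) := by
      refine hmin ⟨⟨sub_nonneg.2 hec, (sub_le_self c he).trans hcd.2⟩, fun v hv => ?_⟩
      rw [o, i]; exact hfe v hv
    have h1 : ∀ v, 0 ≤ outflow e v := fun v => tsum_nonneg (he v)
    have h2 : ∀ v, 0 ≤ inflow e v := fun v => tsum_nonneg fun u => he u v
    have h3 : ∑ v ∈ U, (outflow e v + inflow e v) ≤ 0 := by
      have : ∑ v ∈ U, (outflow (c - e) v + inflow (c - e) v) =
          ∑ v ∈ U, (outflow c v + inflow c v) - ∑ v ∈ U, (outflow e v + inflow e v) := by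
        rw [← Finset.sum_sub_distrib]
        refine Finset.sum_congr rfl fun v _ => ?_
        rw [o, i]; ring
      linarith
    intro v hv
    have h4 := (Finset.single_le_sum (f := fun v => outflow e v + inflow e v)
      (fun v _ => add_nonneg (h1 v) (h2 v)) hv).trans h3
    have := h1 v
    have := h2 v
    constructor <;> linarith
  have tight : ∀ u v, 0 < c u v → u ∈ U ∨ v ∈ U → v ∈ U ∧ inflow c v + σ v ≤ outflow c v := by
    intro u v huv hUV
    by_contra hcon
    obtain ⟨δ, hδ, hδc, hδv⟩ : ∃ δ, 0 < δ ∧ δ ≤ c u v ∧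
        (v ∈ U → outflow c v + δ ≤ inflow c v + σ v) := by
      by_cases hv : v ∈ U
      · have : outflow c v < inflow c v + σ v := by
          by_contra h; exact hcon ⟨hv, not_lt.1 h⟩
        refine ⟨min (c u v) (inflow c v + σ v - outflow c v), lt_min huv (by linarith),
          min_le_left _ _, fun _ => ?_⟩
        linarith [min_le_right (c u v) (inflow c v + σ v - outflow c v)]
      · exact ⟨c u v, huv, le_rfl, fun h => absurd h hv⟩
    have ho : ∀ z, outflow (fun p q => if p = u ∧ q = v then δ else 0) z =
        if z = u then δ else 0 := by
      intro z
      by_cases hz : z = u <;> simp [outflow, hz, tsum_ite_eq]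
    have hi : ∀ z, inflow (fun p q => if p = u ∧ q = v then δ else 0) z =
        if z = v then δ else 0 := by
      intro z
      by_cases hz : z = v <;> simp [inflow, hz, tsum_ite_eq]
    have := pert (fun p q => if p = u ∧ q = v then δ else 0) ?_ ?_ ?_
    · rcases hUV with h | h
      · have := (this u h).1
        rw [ho, if_pos rfl] at this
        linarith
      · have := (this v h).2
        rw [hi, if_pos rfl] at this
        linarith
    · intro p q
      dsimp
      split_ifs <;> [exact hδ.le; exact le_rfl]
    · intro p q
      dsimp
      split_ifs with h
      · rw [h.1, h.2]; exact hδc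
      · exact hc0 p q
    · intro z hz
      rw [ho, hi]
      have := hcU z hz
      by_cases hzv : z = v
      · have := hδv (hzv ▸ hz)
        subst hzv
        split_ifs <;> linarith
      · split_ifs <;> linarith
  have acyclic : ∀ v ∈ U, ¬ Relation.TransGen (fun u t => 0 < c u t) v v := by
    intro v hv hcyc
    obtain ⟨e, K, hK, he, heK, ho, hi⟩ := exists_walk_flow hc0 so si hcyc
    have o : ∀ z, outflow (K⁻¹ • e) z = K⁻¹ * outflow e z := fun z => tsum_mul_left
    have i : ∀ z, inflow (K⁻¹ • e) z = K⁻¹ * inflow e z := fun z => tsum_mul_left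
    have hK' : 0 < K⁻¹ := inv_pos.2 hK
    have := (pert (K⁻¹ • e) (smul_nonneg hK'.le he) ?_ ?_ v hv).1
    · rw [o] at this
      nlinarith
    · calc K⁻¹ • e ≤ K⁻¹ • K • c := smul_le_smul_of_nonneg_left heK hK'.le
        _ = c := by rw [smul_smul, inv_mul_cancel₀ hK.ne', one_smul]
    · intro z hz
      have h1 := hi z
      have h2 := hcU z hz
      rw [o, i, show outflow e z = inflow e z by linarith]
      linarith
  refine ⟨c, hcd, fun v hv => ⟨hcU v hv, ?_, ?_⟩⟩
  · by_cases h : ∃ u, 0 < c u v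
    · obtain ⟨u, hu⟩ := h
      have := (tight u v hu (Or.inr hv)).2
      linarith [min_le_left (σ v) 0]
    · push Not at h
      have h0 : inflow c v ≤ 0 := tsum_nonpos h
      have : 0 ≤ outflow c v := tsum_nonneg (hc0 v)
      linarith [min_le_right (σ v) 0]
  · set S : Finset N := U.filter fun u => Relation.TransGen (fun u t => 0 < c u t) v u with hS
    have reach : ∀ u, Relation.TransGen (fun u t => 0 < c u t) v u →
        u ∈ U ∧ inflow c u + σ u ≤ outflow c u := by
      intro u hu
      induction hu with
      | single h => exact tight _ _ h (Or.inl hv)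
      | tail _ h ih => exact tight _ _ h (Or.inl ih.1)
    have mem_S : ∀ u, u ∈ S ↔ Relation.TransGen (fun u t => 0 < c u t) v u := fun u => by
      rw [hS, Finset.mem_filter]
      exact ⟨fun h => h.2, fun h => ⟨(reach u h).1, h⟩⟩
    have out_eq : ∀ u, u = v ∨ u ∈ S → outflow c u = ∑ t ∈ S, c u t := by
      intro u hu
      refine tsum_eq_sum fun t ht => ?_
      by_contra hne
      have hpos : 0 < c u t := lt_of_le_of_ne (hc0 u t) (Ne.symm hne)
      refine ht ((mem_S t).2 ?_)
      rcases hu with rfl | hu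
      · exact .single hpos
      · exact ((mem_S u).1 hu).tail hpos
    have hvS : v ∉ S := fun h => acyclic v hv ((mem_S v).1 h)
    have in_ge : ∀ t, c v t + ∑ u ∈ S, c u t ≤ inflow c t := by
      intro t
      rw [← Finset.sum_insert (f := fun u => c u t) hvS]
      exact (si t).sum_le_tsum _ fun u _ => hc0 u t
    have h1 : ∑ t ∈ S, (c v t + ∑ u ∈ S, c u t) + ∑ t ∈ S, σ t ≤ ∑ u ∈ S, ∑ t ∈ S, c u t := by
      rw [← Finset.sum_add_distrib]
      refine Finset.sum_le_sum fun u hu => ?_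
      rw [← out_eq u (Or.inr hu)]
      linarith [(reach u ((mem_S u).1 hu)).2, in_ge u]
    rw [Finset.sum_add_distrib, Finset.sum_comm, ← out_eq v (Or.inl rfl)] at h1
    have h2 : σ b ≤ ∑ t ∈ S, σ t := by
      by_cases hbS : b ∈ S
      · rw [← Finset.add_sum_erase _ _ hbS]
        have := Finset.sum_nonneg fun i (hi : i ∈ S.erase b) => hσ i (Finset.ne_of_mem_erase hi)
        linarith
      · have := Finset.sum_nonneg fun i (hi : i ∈ S) =>
          hσ i (fun h => hbS (h ▸ hi))
        linarith
    linarith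

/-- A flow `d` delivering `-σ b` units to `b`, with supply at most `σ v` at each `v ≠ b` but
possibly with further supply from infinity, contains a subflow delivering exactly `-σ b` units to
`b` that sends at most `-σ b` units through every vertex. -/
theorem exists_thin_subflow {N : Type} {d : N → N → ℝ} (hd : 0 ≤ d)
    (hout : ∀ u, Summable (d u)) (hin : ∀ v, Summable fun u => d u v) {b : N} {σ : N → ℝ}
    (hσ : ∀ v, v ≠ b → 0 ≤ σ v) (hb : σ b < 0) (hfeas : ∀ v, outflow d v ≤ inflow d v + σ v) :
    ∃ c ∈ Set.Icc 0 d, ∀ v, outflow c v ≤ inflow c v + σ v ∧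
      inflow c v ≤ outflow c v - min (σ v) 0 ∧ outflow c v ≤ - σ b := by
  let F : Finset N → Set (N → N → ℝ) := fun U => Set.Icc 0 d ∩ ⋂ v ∈ U,
    ({c ∈ Set.Icc 0 d | outflow c v ≤ inflow c v + σ v} ∩
      ({c ∈ Set.Icc 0 d | inflow c v ≤ outflow c v - min (σ v) 0} ∩
        {c ∈ Set.Icc 0 d | outflow c v ≤ - σ b}))
  have hclosed : ∀ U, IsClosed (F U) := fun U => by
    refine isClosed_Icc.inter (isClosed_biInter fun v _ => ?_)
    have ho := continuousOn_outflow hout v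
    have hi := continuousOn_inflow hin v
    exact (isClosed_Icc.isClosed_le ho (hi.add continuousOn_const)).inter
      ((isClosed_Icc.isClosed_le hi (ho.sub continuousOn_const)).inter
        (isClosed_Icc.isClosed_le ho continuousOn_const))
  have hne := IsCompact.nonempty_iInter_of_directed_nonempty_isCompact_isClosed F ?_ ?_ ?_ hclosed
  · obtain ⟨c, hc⟩ := hne
    rw [Set.mem_iInter] at hc
    refine ⟨c, (hc ∅).1, fun v => ?_⟩
    have := (hc {v}).2
    simp only [Finset.mem_singleton, Set.iInter_iInter_eq_left] at this
    exact ⟨this.1.2, this.2.1.2, this.2.2.2⟩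
  · refine directed_of_isDirected_le fun U U' hUU' => ?_
    exact Set.inter_subset_inter_right _ (Set.biInter_subset_biInter_left hUU')
  · intro U
    obtain ⟨c, hc, h⟩ := exists_thin_subflow_on_finset hd hout hin hσ hb hfeas U
    refine ⟨c, hc, Set.mem_iInter₂.2 fun v hv => ?_⟩
    obtain ⟨h1, h2, h3⟩ := h v hv
    exact ⟨⟨hc, h1⟩, ⟨hc, h2⟩, ⟨hc, h3⟩⟩
  · exact fun U => isCompact_Icc.of_isClosed_subset (hclosed U) Set.inter_subset_left

/-- If the nonnegative matrix `g` has row sums at most `R` and column sums at least those of `p`,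
with an excess `θ` in column `b`, then `p` can be changed by at most `3θ` in each row and column so
that only the sum of column `b` changes, by `θ`. -/
theorem exists_matrix_augmentation {V : Type} {p g : V → V → ℝ} (hp : ∀ x y, 0 ≤ p x y)
    (hg : ∀ x y, 0 ≤ g x y) (hpr : ∀ x, Summable (p x)) (hgr : ∀ x, Summable (g x))
    (hpc : ∀ y, Summable fun x => p x y) (hgc : ∀ y, Summable fun x => g x y) {R : V → ℝ}
    (hpR : ∀ x, ∑' y, p x y ≤ R x) (hgR : ∀ x, ∑' y, g x y ≤ R x) {b : V} {θ : ℝ} (hθ : 0 < θ)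
    (hcol : ∀ y, ∑' x, p x y + (if y = b then θ else 0) ≤ ∑' x, g x y) :
    ∃ p' : V → V → ℝ, (∀ x y, 0 ≤ p' x y) ∧ (∀ x y, p x y = 0 → g x y = 0 → p' x y = 0) ∧
      (∀ x, Summable (p' x) ∧ ∑' y, p' x y ≤ R x) ∧
      (∀ y, HasSum (fun x => p' x y) (∑' x, p x y + if y = b then θ else 0)) ∧
      (∀ x (s : Finset V), ∑ y ∈ s, |p' x y - p x y| ≤ 3 * θ) ∧
      (∀ y (s : Finset V), ∑ x ∈ s, |p' x y - p x y| ≤ 3 * θ) := by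
  let d : V ⊕ V → V ⊕ V → ℝ := fun u v =>
    match u, v with
    | .inl x, .inr y => max (g x y - p x y) 0
    | .inr y, .inl x => max (p x y - g x y) 0
    | .inl _, .inl _ => 0
    | .inr _, .inr _ => 0
  let σ : V ⊕ V → ℝ := Sum.elim (fun x => R x - ∑' y, p x y) fun y => if y = b then -θ else 0
  have hd : 0 ≤ d := by
    rintro (x | x) (y | y) <;> simp [d]
  have hσb : σ (.inr b) = -θ := by simp [σ]
  -- sums over `V ⊕ V` reduce to sums over one copy of `V`
  have red : ∀ c ∈ Set.Icc 0 d,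
      (∀ x, outflow c (.inl x) = ∑' y, c (.inl x) (.inr y)) ∧
      (∀ x, inflow c (.inl x) = ∑' y, c (.inr y) (.inl x)) ∧
      (∀ y, outflow c (.inr y) = ∑' x, c (.inr y) (.inl x)) ∧
      (∀ y, inflow c (.inr y) = ∑' x, c (.inl x) (.inr y)) := by
    intro c hc
    have hl : ∀ x y, c (.inl x) (.inl y) = 0 := fun x y => le_antisymm (hc.2 _ _) (hc.1 _ _)
    have hr : ∀ x y, c (.inr x) (.inr y) = 0 := fun x y => le_antisymm (hc.2 _ _) (hc.1 _ _)
    refine ⟨fun x => (Sum.inr_injective.tsum_eq ?_).symm, fun x => ?_,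
      fun y => (Sum.inl_injective.tsum_eq ?_).symm, fun y => ?_⟩
    · rintro (y | y) h
      · exact absurd (hl x y) h
      · exact ⟨y, rfl⟩
    · refine (Sum.inr_injective.tsum_eq (f := fun u => c u (.inl x)) ?_).symm
      rintro (y | y) h
      · exact absurd (hl y x) h
      · exact ⟨y, rfl⟩
    · rintro (x | x) h
      · exact ⟨x, rfl⟩
      · exact absurd (hr y x) h
    · refine (Sum.inl_injective.tsum_eq (f := fun u => c u (.inr y)) ?_).symm
      rintro (x | x) h
      · exact ⟨x, rfl⟩
      · exact absurd (hr x y) h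
  have bd1 : ∀ x y, max (g x y - p x y) 0 ≤ g x y := fun x y =>
    max_le (sub_le_self _ (hp x y)) (hg x y)
  have bd2 : ∀ x y, max (p x y - g x y) 0 ≤ p x y := fun x y =>
    max_le (sub_le_self _ (hg x y)) (hp x y)
  have sr1 : ∀ x, Summable fun y => max (g x y - p x y) 0 := fun x =>
    Summable.of_nonneg_of_le (fun y => le_max_right _ _) (bd1 x) (hgr x)
  have sr2 : ∀ x, Summable fun y => max (p x y - g x y) 0 := fun x =>
    Summable.of_nonneg_of_le (fun y => le_max_right _ _) (bd2 x) (hpr x)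
  have sc1 : ∀ y, Summable fun x => max (g x y - p x y) 0 := fun y =>
    Summable.of_nonneg_of_le (fun x => le_max_right _ _) (fun x => bd1 x y) (hgc y)
  have sc2 : ∀ y, Summable fun x => max (p x y - g x y) 0 := fun y =>
    Summable.of_nonneg_of_le (fun x => le_max_right _ _) (fun x => bd2 x y) (hpc y)
  have diff : ∀ x y, max (g x y - p x y) 0 - max (p x y - g x y) 0 = g x y - p x y := by
    intro x y
    rcases le_total (g x y) (p x y) with h | h
    · rw [max_eq_right (by linarith), max_eq_left (by linarith)]; ring
    · rw [max_eq_left (by linarith), max_eq_right (by linarith)]; ring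
  have hout : ∀ u, Summable (d u) := by
    rintro (x | y)
    · refine (Sum.inr_injective.summable_iff ?_).1 (sr1 x)
      rintro (z | z) h
      · rfl
      · exact absurd ⟨z, rfl⟩ h
    · refine (Sum.inl_injective.summable_iff ?_).1 (sc2 y)
      rintro (z | z) h
      · exact absurd ⟨z, rfl⟩ h
      · rfl
  have hin : ∀ v, Summable fun u => d u v := by
    rintro (x | y)
    · refine (Sum.inr_injective.summable_iff ?_).1 (sr2 x)
      rintro (z | z) h
      · rfl
      · exact absurd ⟨z, rfl⟩ h
    · refine (Sum.inl_injective.summable_iff ?_).1 (sc1 y)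
      rintro (z | z) h
      · exact absurd ⟨z, rfl⟩ h
      · rfl
  have hfeas : ∀ v, outflow d v ≤ inflow d v + σ v := by
    obtain ⟨h1, h2, h3, h4⟩ := red d ⟨hd, le_rfl⟩
    rintro (x | y)
    · have := (sr1 x).tsum_sub (sr2 x)
      simp only [diff, (hgr x).tsum_sub (hpr x)] at this
      rw [h1, h2]
      simp only [d, σ, Sum.elim_inl]
      linarith [hgR x]
    · have := (sc1 y).tsum_sub (sc2 y)
      simp only [diff, (hgc y).tsum_sub (hpc y)] at this
      rw [h3, h4]
      simp only [d, σ, Sum.elim_inr]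
      have := hcol y
      split_ifs at this ⊢ <;> linarith
  have hσ : ∀ v, v ≠ .inr b → 0 ≤ σ v := by
    rintro (x | y) h
    · exact sub_nonneg.2 (hpR x)
    · have : y ≠ b := fun hy => h (hy ▸ rfl)
      simp [σ, this]
  obtain ⟨c, hc, hcv⟩ := exists_thin_subflow hd hout hin hσ (by rw [hσb]; linarith) hfeas
  rw [hσb, neg_neg] at hcv
  obtain ⟨h1, h2, h3, h4⟩ := red c hc
  have ha : ∀ x y, 0 ≤ c (.inl x) (.inr y) := fun x y => hc.1 _ _
  have hb : ∀ x y, 0 ≤ c (.inr y) (.inl x) := fun x y => hc.1 _ _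
  have ha' : ∀ x y, c (.inl x) (.inr y) ≤ max (g x y - p x y) 0 := fun x y => hc.2 _ _
  have hb' : ∀ x y, c (.inr y) (.inl x) ≤ max (p x y - g x y) 0 := fun x y => hc.2 _ _
  have ar : ∀ x, Summable fun y => c (.inl x) (.inr y) := fun x =>
    Summable.of_nonneg_of_le (ha x) (ha' x) (sr1 x)
  have br : ∀ x, Summable fun y => c (.inr y) (.inl x) := fun x =>
    Summable.of_nonneg_of_le (hb x) (hb' x) (sr2 x)
  have ac : ∀ y, Summable fun x => c (.inl x) (.inr y) := fun y =>
    Summable.of_nonneg_of_le (fun x => ha x y) (fun x => ha' x y) (sc1 y)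
  have bc : ∀ y, Summable fun x => c (.inr y) (.inl x) := fun y =>
    Summable.of_nonneg_of_le (fun x => hb x y) (fun x => hb' x y) (sc2 y)
  have hmin : ∀ v, -θ ≤ min (σ v) 0 := by
    intro v
    by_cases h : v = .inr b
    · rw [h, hσb]; exact le_min le_rfl (by linarith)
    · rw [min_eq_right (hσ v h)]; linarith
  have habs : ∀ x y, |p x y + c (.inl x) (.inr y) - c (.inr y) (.inl x) - p x y| ≤
      c (.inl x) (.inr y) + c (.inr y) (.inl x) := by
    intro x y
    rw [abs_le]
    constructor <;> linarith [ha x y, hb x y]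
  refine ⟨fun x y => p x y + c (.inl x) (.inr y) - c (.inr y) (.inl x), ?_, ?_, ?_, ?_, ?_, ?_⟩
  · intro x y
    linarith [ha x y, hb' x y, bd2 x y]
  · intro x y h h'
    have e1 := ha' x y
    have e2 := hb' x y
    simp only [h, h', sub_zero, max_self] at e1 e2
    simp only [h]
    linarith [ha x y, hb x y]
  · intro x
    refine ⟨((hpr x).add (ar x)).sub (br x), ?_⟩
    rw [((hpr x).add (ar x)).tsum_sub (br x), (hpr x).tsum_add (ar x)]
    have := (hcv (.inl x)).1
    rw [h1, h2] at this
    simp only [σ, Sum.elim_inl] at this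
    linarith
  · intro y
    have hs := ((hpc y).hasSum.add (ac y).hasSum).sub (bc y).hasSum
    suffices h : (∑' x, p x y + if y = b then θ else 0) = ∑' x, p x y +
        ∑' x, c (.inl x) (.inr y) - ∑' x, c (.inr y) (.inl x) by rw [h]; exact hs
    obtain ⟨i1, i2, -⟩ := hcv (.inr y)
    rw [h3, h4] at i1 i2
    by_cases hy : y = b
    · subst hy
      rw [hσb] at i1 i2
      rw [min_eq_left (by linarith)] at i2
      rw [if_pos rfl]
      linarith
    · simp only [σ, Sum.elim_inr, if_neg hy, min_self] at i1 i2
      rw [if_neg hy]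
      linarith
  · intro x s
    refine (Finset.sum_le_sum fun y _ => habs x y).trans ?_
    refine (((ar x).add (br x)).sum_le_tsum s fun y _ => add_nonneg (ha x y) (hb x y)).trans ?_
    rw [(ar x).tsum_add (br x), ← h1, ← h2]
    linarith [(hcv (.inl x)).2.1, (hcv (.inl x)).2.2, hmin (.inl x)]
  · intro y s
    refine (Finset.sum_le_sum fun x _ => habs x y).trans ?_
    refine (((ac y).add (bc y)).sum_le_tsum s fun x _ => add_nonneg (ha x y) (hb x y)).trans ?_
    rw [(ac y).tsum_add (bc y), ← h3, ← h4]
    linarith [(hcv (.inr y)).2.1, (hcv (.inr y)).2.2, hmin (.inr y)]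

/-- Edges of a bipartite web that can carry a positive current. -/
def IsCarrier (W : Web V) (x y : V) : Prop := (x, y) ∈ W.D ∧ x ∉ W.B ∧ y ∉ W.A

def carrierNbhd (W : Web V) (X : Set V) : Set V := {y | ∃ x ∈ X, IsCarrier W x y}

/-- `p` is a current out of `X` saturating all neighbours of `X`, except for a deficit of exactly
`ε` at `b`. -/
structure IsDeficientWave (W : Web V) (b : V) (ε : ℝ) (X : Set V) (p : V → V → ℝ) : Prop where
  nonneg : ∀ x y, 0 ≤ p x y
  supp : ∀ x y, p x y ≠ 0 → x ∈ X ∧ IsCarrier W x y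
  row : ∀ x, Summable (p x) ∧ ∑' y, p x y ≤ W.w x
  col : ∀ y ∈ carrierNbhd W X, y ≠ b → HasSum (fun x => p x y) (W.w y)
  col_root : HasSum (fun x => p x b) (W.w b - ε)

namespace IsDeficientWave

variable {W : Web V} {b : V} {ε : ℝ} {X : Set V} {p : V → V → ℝ}

theorem eq_zero_of_notMem (h : IsDeficientWave W b ε X p) {x y : V}
    (hy : y ∉ carrierNbhd W X) : p x y = 0 := by
  by_contra hne
  exact hy ⟨x, h.supp x y hne⟩

theorem summable_col (h : IsDeficientWave W b ε X p) (y : V) : Summable fun x => p x y := by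
  by_cases hy : y ∈ carrierNbhd W X
  · by_cases hyb : y = b
    · exact hyb ▸ h.col_root.summable
    · exact (h.col y hy hyb).summable
  · simp only [h.eq_zero_of_notMem hy]
    exact summable_zero

/-- A deficient wave can be enlarged so as to reach a smaller prescribed deficit, moving it only
slightly at the vertices it already uses. -/
theorem exists_improvement {ε' : ℝ} {X' : Set V} {f : V → V → ℝ}
    (h : IsDeficientWave W b ε X p) (h' : IsDeficientWave W b ε' X' f) (hε : ε' < ε) :
    ∃ p', IsDeficientWave W b ε' (X ∪ X') p' ∧
      (∀ x ∈ X, ∀ s : Finset V, ∑ y ∈ s, |p' x y - p x y| ≤ 3 * (ε - ε')) ∧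
      (∀ y ∈ insert b (carrierNbhd W X), ∀ s : Finset V,
        ∑ x ∈ s, |p' x y - p x y| ≤ 3 * (ε - ε')) := by
  set Y : Set V := insert b (carrierNbhd W X) with hY
  set q : V → V → ℝ := fun x y => if y ∈ Y then p x y else f x y with hq
  set g : V → V → ℝ := fun x y => if x ∈ X' then f x y else q x y with hg
  have q_in : ∀ {x y}, y ∈ Y → q x y = p x y := fun hy => if_pos hy
  have q_out : ∀ {x y}, y ∉ Y → q x y = f x y := fun hy => if_neg hy
  have g_in : ∀ {x y}, x ∈ X' → g x y = f x y := fun hx => if_pos hx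
  have g_out : ∀ {x y}, x ∉ X' → g x y = q x y := fun hx => if_neg hx
  have q0 : ∀ x y, 0 ≤ q x y := fun x y => by
    by_cases hy : y ∈ Y
    · rw [q_in hy]; exact h.nonneg x y
    · rw [q_out hy]; exact h'.nonneg x y
  have g0 : ∀ x y, 0 ≤ g x y := fun x y => by
    by_cases hx : x ∈ X'
    · rw [g_in hx]; exact h'.nonneg x y
    · rw [g_out hx]; exact q0 x y
  have f_zero : ∀ {x y}, x ∉ X' → f x y = 0 := fun hx => by
    by_contra hne; exact hx (h'.supp _ _ hne).1
  have p_zero : ∀ {x y}, x ∉ X → p x y = 0 := fun hx => by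
    by_contra hne; exact hx (h.supp _ _ hne).1
  have q_row : ∀ {x}, x ∈ X → q x = p x := fun {x} hx => by
    funext y
    by_cases hy : y ∈ Y
    · exact q_in hy
    · have hy' : y ∉ carrierNbhd W X := fun hn => hy (Set.mem_insert_of_mem b hn)
      rw [q_out hy, h.eq_zero_of_notMem hy']
      by_contra hne
      exact hy' ⟨x, hx, (h'.supp _ _ hne).2⟩
  have q_le : ∀ {x}, x ∉ X → ∀ y, q x y ≤ f x y := fun hx y => by
    by_cases hy : y ∈ Y
    · rw [q_in hy, p_zero hx]; exact h'.nonneg _ _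
    · rw [q_out hy]
  have q_r : ∀ x, Summable (q x) ∧ ∑' y, q x y ≤ W.w x := fun x => by
    by_cases hx : x ∈ X
    · rw [q_row hx]; exact h.row x
    · have hs := Summable.of_nonneg_of_le (q0 x) (q_le hx) (h'.row x).1
      exact ⟨hs, (hs.tsum_le_tsum (q_le hx) (h'.row x).1).trans (h'.row x).2⟩
  have g_r : ∀ x, Summable (g x) ∧ ∑' y, g x y ≤ W.w x := fun x => by
    by_cases hx : x ∈ X'
    · rw [show g x = f x from funext fun y => g_in hx]; exact h'.row x
    · rw [show g x = q x from funext fun y => g_out hx]; exact q_r x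
  have q_c : ∀ y, Summable fun x => q x y := fun y => by
    by_cases hy : y ∈ Y
    · simp only [q_in hy]; exact h.summable_col y
    · simp only [q_out hy]; exact h'.summable_col y
  have f_le_g : ∀ x y, f x y ≤ g x y := fun x y => by
    by_cases hx : x ∈ X'
    · rw [g_in hx]
    · rw [f_zero hx]; exact g0 x y
  have g_c : ∀ y, Summable fun x => g x y := fun y => by
    refine Summable.of_nonneg_of_le (fun x => g0 x y) (fun x => ?_) ((h'.summable_col y).add (q_c y))
    by_cases hx : x ∈ X'
    · rw [g_in hx]; linarith [q0 x y]
    · rw [g_out hx]; linarith [h'.nonneg x y]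
  have hcol : ∀ y, ∑' x, q x y + (if y = b then ε - ε' else 0) ≤ ∑' x, g x y := fun y => by
    have hfg : ∑' x, f x y ≤ ∑' x, g x y :=
      (h'.summable_col y).tsum_le_tsum (fun x => f_le_g x y) (g_c y)
    by_cases hyb : y = b
    · subst hyb
      have hyY : y ∈ Y := Set.mem_insert y _
      rw [h'.col_root.tsum_eq] at hfg
      simp only [q_in hyY, h.col_root.tsum_eq, if_true]
      linarith
    · rw [if_neg hyb, add_zero]
      by_cases hy : y ∈ Y
      · have hyX : y ∈ carrierNbhd W X := hy.resolve_left hyb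
        simp only [q_in hy]
        by_cases hyX' : y ∈ carrierNbhd W X'
        · rw [(h.col y hyX hyb).tsum_eq, ← (h'.col y hyX' hyb).tsum_eq]
          exact hfg
        · refine (h.summable_col y).tsum_le_tsum (fun x => ?_) (g_c y)
          by_cases hx : x ∈ X'
          · have : p x y = 0 := by
              by_contra hne
              exact hyX' ⟨x, hx, (h.supp x y hne).2⟩
            rw [this]; exact g0 x y
          · rw [g_out hx, q_in hy]
      · simp only [q_out hy]
        exact hfg
  obtain ⟨p', hp'0, hsupp, hrow, hpcol, hr, hc⟩ := exists_matrix_augmentation q0 g0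
    (fun x => (q_r x).1) (fun x => (g_r x).1) q_c g_c (fun x => (q_r x).2) (fun x => (g_r x).2)
    (sub_pos.2 hε) hcol
  have q_supp : ∀ x y, q x y ≠ 0 → x ∈ X ∪ X' ∧ IsCarrier W x y := fun x y hne => by
    by_cases hy : y ∈ Y
    · rw [q_in hy] at hne
      exact ⟨Or.inl (h.supp x y hne).1, (h.supp x y hne).2⟩
    · rw [q_out hy] at hne
      exact ⟨Or.inr (h'.supp x y hne).1, (h'.supp x y hne).2⟩
  refine ⟨p', ⟨hp'0, fun x y hne => ?_, hrow, fun y hy hyb => ?_, ?_⟩, fun x hx s => ?_,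
    fun y hy s => ?_⟩
  · by_contra hcon
    have hqz : q x y = 0 := by
      by_contra hne'; exact hcon (q_supp x y hne')
    refine hne (hsupp x y hqz ?_)
    by_cases hx : x ∈ X'
    · rw [g_in hx]
      by_contra hne'
      exact hcon ⟨Or.inr hx, (h'.supp x y hne').2⟩
    · rw [g_out hx, hqz]
  · have := hpcol y
    rw [if_neg hyb, add_zero] at this
    convert this using 1
    symm
    by_cases hyY : y ∈ Y
    · simp only [q_in hyY]
      exact (h.col y (hyY.resolve_left hyb) hyb).tsum_eq
    · simp only [q_out hyY]
      obtain ⟨x, hx, hxy⟩ := hy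
      refine (h'.col y ⟨x, hx.resolve_left fun hxX => ?_, hxy⟩ hyb).tsum_eq
      exact hyY (Set.mem_insert_of_mem b ⟨x, hxX, hxy⟩)
  · have := hpcol b
    rw [if_pos rfl] at this
    simp only [q_in (Set.mem_insert b (carrierNbhd W X)), h.col_root.tsum_eq] at this
    convert this using 1
    ring
  · have := hr x s
    rwa [q_row hx] at this
  · have := hc y s
    simpa only [q_in hy] using this

end IsDeficientWave

theorem hasSum_of_uniform_approx {ι : Type} {r : ℕ → ι → ℝ} {q : ι → ℝ} {a e : ℕ → ℝ} {c : ℝ}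
    (hr : ∀ n, HasSum (r n) (a n)) (ha : Filter.Tendsto a Filter.atTop (nhds c))
    (he : Filter.Tendsto e Filter.atTop (nhds 0))
    (hq : ∀ n (s : Finset ι), ∑ x ∈ s, |q x - r n x| ≤ e n) : HasSum q c := by
  have hu : TendstoUniformlyOnFilter (fun n (s : Finset ι) => ∑ x ∈ s, r n x)
      (fun s => ∑ x ∈ s, q x) Filter.atTop (SummationFilter.unconditional ι).filter := by
    refine TendstoUniformly.tendstoUniformlyOnFilter ?_ |>.mono_right le_top
    rw [Metric.tendstoUniformly_iff]
    intro δ hδ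
    filter_upwards [he.eventually_lt_const hδ] with n hn s
    rw [Real.dist_eq, ← Finset.sum_sub_distrib]
    exact ((Finset.abs_sum_le_sum_abs _ _).trans (hq n s)).trans_lt hn
  exact hu.tendsto_of_eventually_tendsto (Filter.Eventually.of_forall hr) ha

theorem IsDeficientWave.exists_limit {W : Web V} {b : V} {ε : ℕ → ℝ} {X : ℕ → Set V}
    {p : ℕ → V → V → ℝ} (h : ∀ n, IsDeficientWave W b (ε n) (X n) (p n)) (hX : Monotone X)
    (hε0 : ∀ n, 0 ≤ ε n) (hε : Filter.Tendsto ε Filter.atTop (nhds 0))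
    (hrow : ∀ n, ∀ x ∈ X n, ∀ s : Finset V,
      ∑ y ∈ s, |p (n + 1) x y - p n x y| ≤ 3 * (ε n - ε (n + 1)))
    (hcol : ∀ n, ∀ y ∈ insert b (carrierNbhd W (X n)), ∀ s : Finset V,
      ∑ x ∈ s, |p (n + 1) x y - p n x y| ≤ 3 * (ε n - ε (n + 1))) :
    ∃ q, IsDeficientWave W b 0 (⋃ n, X n) q := by
  have mono_nbhd : ∀ {m k}, m ≤ k →
      insert b (carrierNbhd W (X m)) ⊆ insert b (carrierNbhd W (X k)) := fun hmk =>
    Set.insert_subset_insert fun y ⟨x, hx, hxy⟩ => ⟨x, hX hmk hx, hxy⟩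
  have hrow' : ∀ m, ∀ x ∈ X m, ∀ (s : Finset V) k, m ≤ k →
      ∑ y ∈ s, |p k x y - p m x y| ≤ 3 * (ε m - ε k) := by
    intro m x hx s k hmk
    induction k, hmk using Nat.le_induction with
    | base => simp
    | succ k hmk ih =>
      have h1 := hrow k x (hX hmk hx) s
      have h2 : ∑ y ∈ s, |p (k + 1) x y - p m x y| ≤
          ∑ y ∈ s, |p (k + 1) x y - p k x y| + ∑ y ∈ s, |p k x y - p m x y| := by
        rw [← Finset.sum_add_distrib]
        exact Finset.sum_le_sum fun y _ => abs_sub_le _ _ _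
      linarith
  have hcol' : ∀ m, ∀ y ∈ insert b (carrierNbhd W (X m)), ∀ (s : Finset V) k, m ≤ k →
      ∑ x ∈ s, |p k x y - p m x y| ≤ 3 * (ε m - ε k) := by
    intro m y hy s k hmk
    induction k, hmk using Nat.le_induction with
    | base => simp
    | succ k hmk ih =>
      have h1 := hcol k y (mono_nbhd hmk hy) s
      have h2 : ∑ x ∈ s, |p (k + 1) x y - p m x y| ≤
          ∑ x ∈ s, |p (k + 1) x y - p k x y| + ∑ x ∈ s, |p k x y - p m x y| := by
        rw [← Finset.sum_add_distrib]
        exact Finset.sum_le_sum fun y _ => abs_sub_le _ _ _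
      linarith
  have hlim : ∀ x y, ∃ l, Filter.Tendsto (fun n => p n x y) Filter.atTop (nhds l) := by
    intro x y
    by_cases hx : ∃ m, x ∈ X m
    · obtain ⟨m, hm⟩ := hx
      have hc : CauchySeq fun n => p (n + m) x y := by
        refine cauchySeq_of_le_tendsto_0' (fun n => 3 * ε (n + m)) (fun n k hnk => ?_) ?_
        · have := hrow' (n + m) x (hX (Nat.le_add_left m n) hm) {y} (k + m) (by omega)
          rw [Finset.sum_singleton] at this
          rw [dist_comm, Real.dist_eq]
          linarith [hε0 (k + m)]
        · simpa using ((Filter.tendsto_add_atTop_iff_nat m).2 hε).const_mul 3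
      obtain ⟨l, hl⟩ := cauchySeq_tendsto_of_complete hc
      exact ⟨l, (Filter.tendsto_add_atTop_iff_nat (f := fun n => p n x y) m).1 hl⟩
    · refine ⟨0, ?_⟩
      have : ∀ n, p n x y = 0 := fun n => by
        by_contra hne
        exact hx ⟨n, ((h n).supp x y hne).1⟩
      simp only [this]
      exact tendsto_const_nhds
  choose q hq using hlim
  have q0 : ∀ x y, 0 ≤ q x y := fun x y =>
    ge_of_tendsto' (hq x y) fun n => (h n).nonneg x y
  have hfin : ∀ x (s : Finset V), ∑ y ∈ s, q x y ≤ W.w x := fun x s => by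
    refine le_of_tendsto' (tendsto_finsetSum s fun y _ => hq x y) fun n => ?_
    exact (((h n).row x).1.sum_le_tsum s fun y _ => (h n).nonneg x y).trans ((h n).row x).2
  have happrox : ∀ m, ∀ y ∈ insert b (carrierNbhd W (X m)), ∀ s : Finset V,
      ∑ x ∈ s, |q x y - p m x y| ≤ 3 * ε m := by
    intro m y hy s
    refine le_of_tendsto (tendsto_finsetSum s fun x _ => ((hq x y).sub_const (p m x y)).abs) ?_
    filter_upwards [Filter.eventually_ge_atTop m] with k hk
    linarith [hcol' m y hy s k hk, hε0 k]
  have he : ∀ m, Filter.Tendsto (fun n => 3 * ε (n + m)) Filter.atTop (nhds 0) := fun m => by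
    simpa using ((Filter.tendsto_add_atTop_iff_nat m).2 hε).const_mul 3
  refine ⟨q, q0, fun x y hne => ?_, fun x => ?_, fun y hy hyb => ?_, ?_⟩
  · have : ∃ n, p n x y ≠ 0 := by
      by_contra hcon
      push Not at hcon
      refine hne (tendsto_nhds_unique (hq x y) ?_)
      simp only [hcon]
      exact tendsto_const_nhds
    obtain ⟨n, hn⟩ := this
    exact ⟨Set.mem_iUnion.2 ⟨n, ((h n).supp x y hn).1⟩, ((h n).supp x y hn).2⟩
  · have hs := summable_of_sum_le (q0 x) (hfin x)
    exact ⟨hs, hs.tsum_le_of_sum_le (hfin x)⟩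
  · obtain ⟨x, hx, hxy⟩ := hy
    obtain ⟨m, hm⟩ := Set.mem_iUnion.1 hx
    have hy : ∀ n, y ∈ carrierNbhd W (X (n + m)) := fun n =>
      ⟨x, hX (Nat.le_add_left m n) hm, hxy⟩
    exact hasSum_of_uniform_approx (fun n => (h (n + m)).col y (hy n) hyb) tendsto_const_nhds
      (he m) fun n => happrox (n + m) y (Set.mem_insert_of_mem b (hy n))
  · refine hasSum_of_uniform_approx (fun n => (h n).col_root) (hε.const_sub _) (he 0) fun n => ?_
    exact happrox n b (Set.mem_insert b _)

/-- A current in a bipartite web saturating every neighbour of its sources is a wave. -/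
theorem isWave_of_saturated {W : Web V} (hbip : Bipartite W) {f : V × V → ℝ≥0} {X : Set V}
    (hsupp : ∀ x y, f (x, y) ≠ 0 → x ∈ X ∧ IsCarrier W x y)
    (hrow : ∀ x, dplus f x ≤ W.w x) (hcol : ∀ y ∈ carrierNbhd W X, dminus f y = W.w y) :
    IsWave W f := by
  have hout : ∀ x, dplus f x ≠ 0 → ∃ y, f (x, y) ≠ 0 := fun x hx => by
    by_contra hcon
    push Not at hcon
    exact hx (by simp [dplus, hcon])
  have hin : ∀ y, dminus f y ≠ 0 → ∃ x, f (x, y) ≠ 0 := fun y hy => by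
    by_contra hcon
    push Not at hcon
    exact hy (by simp [dminus, hcon])
  have hB : ∀ x ∈ W.B, dplus f x = 0 := fun x hx => by
    by_contra hne
    obtain ⟨y, hy⟩ := hout x hne
    exact (hsupp x y hy).2.2.1 hx
  have hcur : IsCurrent W f := by
    refine ⟨fun ⟨x, y⟩ he => ?_, hrow, fun y => ?_, fun x hx => ?_, fun y hy => ?_, hB⟩
    · by_contra hne
      exact he (hsupp x y hne).2.1
    · by_cases hy : dminus f y = 0
      · rw [hy]; exact zero_le
      · obtain ⟨x, hx⟩ := hin y hy
        exact (hcol y ⟨x, hsupp x y hx⟩).le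
    · have : dplus f x = 0 := by
        by_contra hne
        obtain ⟨y, hy⟩ := hout x hne
        exact hx (hbip.2 _ (hsupp x y hy).2.1).1
      rw [this]; exact zero_le
    · by_contra hne
      obtain ⟨x, hx⟩ := hin y hne
      exact (hsupp x y hx).2.2.2 hy
  have hnext : ∀ x ∈ X, x ∉ W.B → ∀ p : List V, IsABPath W.D {x} W.B p →
      ∃ z ∈ TER W f, z ∈ p := by
    rintro x hx hxB p ⟨hwalk, ⟨a, ha, hhead⟩, ⟨c, hc, hlast⟩⟩
    obtain rfl : a = x := ha
    match p with
    | [] => simp at hhead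
    | [y] =>
      simp only [List.head?_cons, Option.some.injEq] at hhead
      simp only [List.getLast?_singleton, Option.some.injEq] at hlast
      exact absurd (hhead ▸ hlast ▸ hc) hxB
    | y :: z :: l =>
      simp only [List.head?_cons, Option.some.injEq] at hhead
      subst hhead
      have hyz : (y, z) ∈ W.D := (List.isChain_cons_cons.1 hwalk).1
      refine ⟨z, ⟨?_, hB z (hbip.2 _ hyz).2⟩, by simp⟩
      by_cases hz : z ∈ W.A
      · exact Or.inl hz
      · exact Or.inr (hcol z ⟨y, hx, hyz, hxB, hz⟩)
  have hroof : ∀ x, dplus f x ≠ 0 → ∀ p : List V, IsABPath W.D {x} W.B p →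
      ∃ z ∈ TER W f, z ∈ p := by
    intro x hx
    obtain ⟨y, hy⟩ := hout x hx
    exact hnext x (hsupp x y hy).1 (hsupp x y hy).2.2.1
  refine ⟨hcur, fun p hp => ?_, fun x hx => ?_⟩
  · obtain ⟨hwalk, ⟨a, ha, hhead⟩, hend⟩ := hp
    by_cases h0 : dplus f a = 0
    · exact ⟨a, ⟨Or.inl ha, h0⟩, List.mem_of_mem_head? hhead⟩
    · exact hroof a h0 p ⟨hwalk, ⟨a, rfl, hhead⟩, hend⟩
  · by_contra hne
    exact hx (hroof x hne)

/-- `W` with the weight of `b` decreased by `ε`. -/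
noncomputable abbrev Web.decrease (W : Web V) (b : V) (ε : ℝ≥0) : Web V :=
  {W with w := fun v => if v = b then W.w v - ε else W.w v}

theorem isABPath_pair {W : Web V} (hbip : Bipartite W) {A : Set V} {x y : V} (hx : x ∈ A)
    (hxy : (x, y) ∈ W.D) : IsABPath W.D A W.B [x, y] :=
  ⟨List.isChain_pair.2 hxy, ⟨x, hx, rfl⟩, ⟨y, (hbip.2 _ hxy).2, rfl⟩⟩

theorem IsHindrance.exists_saturating {W : Web V} (hbip : Bipartite W) {f : V × V → ℝ≥0}
    (hf : IsHindrance W f) :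
    ∃ X : Set V, (∀ x y, f (x, y) ≠ 0 → x ∈ X ∧ IsCarrier W x y) ∧
      (∀ y ∈ carrierNbhd W X, dminus f y = W.w y) ∧
      ∃ a ∈ X, a ∈ W.A ∧ a ∉ W.B ∧ dplus f a < W.w a := by
  obtain ⟨⟨hcur, hsep, -⟩, a, haA, hess, hlt⟩ := hf
  have hout : ∀ {x y}, f (x, y) ≠ 0 → dplus f x ≠ 0 := fun hxy h0 =>
    hxy (by simpa [dplus] using congrFun (ENNReal.tsum_eq_zero.1 h0 |> funext) _)
  have hin : ∀ {x y}, f (x, y) ≠ 0 → dminus f y ≠ 0 := fun hxy h0 =>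
    hxy (by simpa [dminus] using congrFun (ENNReal.tsum_eq_zero.1 h0 |> funext) _)
  have haB : a ∉ W.B := fun haB =>
    hess ⟨⟨Or.inl haA, hcur.b_out a haB⟩, [a],
      ⟨List.isChain_singleton a, ⟨a, rfl, rfl⟩, ⟨a, haB, rfl⟩⟩, by simp⟩
  refine ⟨insert a {x | dplus f x ≠ 0}, fun x y hxy => ⟨Or.inr (hout hxy), ?_, ?_, ?_⟩, ?_,
    a, Or.inl rfl, haA, haB, hlt⟩
  · by_contra h; exact hxy (hcur.supp _ h)
  · exact fun hx => hout hxy (hcur.b_out x hx)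
  · exact fun hy => hin hxy (hcur.a_in y hy)
  · rintro y ⟨x, hx, hxy, -, hyA⟩
    suffices hy : y ∈ TER W f from hy.1.resolve_left hyA
    by_cases h0 : dplus f x = 0
    · obtain rfl : x = a := hx.resolve_right fun h => h h0
      by_contra hy
      refine hess ⟨⟨Or.inl haA, h0⟩, [x, y], isABPath_pair hbip rfl hxy, fun z hz hzT => ?_⟩
      rcases List.mem_pair.1 hz with rfl | rfl
      · rfl
      · exact absurd hzT hy
    · obtain ⟨z, hzT, hz⟩ := hsep _ (isABPath_pair hbip (hbip.2 _ hxy).1 hxy)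
      rcases List.mem_pair.1 hz with rfl | rfl
      · exact absurd hzT.2 h0
      · exact hzT

theorem hasSum_coe_real_of_tsum_eq {ι : Type} {f : ι → ℝ≥0} {a : ℝ≥0}
    (h : ∑' i, (f i : ℝ≥0∞) = a) : HasSum (fun i => (f i : ℝ)) a := by
  rw [NNReal.hasSum_coe]
  exact ENNReal.hasSum_coe.1 (h ▸ ENNReal.summable.hasSum)

theorem Hindered.exists_isDeficientWave {W : Web V} (hbip : Bipartite W) (hloose : Loose W)
    {b : V} {ε : ℝ≥0} (hε : ε ≤ W.w b) (h : Hindered (W.decrease b ε)) :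
    ∃ X p, IsDeficientWave W b ε X p := by
  obtain ⟨f, hf⟩ := h
  obtain ⟨X, hsupp, hcol, a, haX, haA, haB, hlt⟩ :=
    IsHindrance.exists_saturating (W := W.decrease b ε) hbip hf
  replace hsupp : ∀ x y, f (x, y) ≠ 0 → x ∈ X ∧ IsCarrier W x y := hsupp
  have hle : ∀ x, (W.decrease b ε).w x ≤ W.w x := fun x => by
    dsimp only [Web.decrease]
    split_ifs
    exacts [tsub_le_self, le_rfl]
  have hne : ∀ y ∈ carrierNbhd W X, y ≠ b → dminus f y = W.w y := fun y hy hyb => by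
    simpa [hyb] using hcol y hy
  have hrow : ∀ x, dplus f x ≤ W.w x := fun x =>
    (hf.1.1.out_le x).trans (ENNReal.coe_le_coe.2 (hle x))
  have hbX : b ∈ carrierNbhd W X := by
    by_contra hbX
    have hwave : IsWave W f := isWave_of_saturated hbip hsupp hrow fun y hy =>
      hne y hy fun h => hbX (h ▸ hy)
    obtain rfl : f = fun _ => 0 := funext (hloose.1 f hwave)
    refine hloose.2 ⟨hwave, a, haA, ?_, hlt.trans_le (ENNReal.coe_le_coe.2 (hle a))⟩
    rintro ⟨-, p, ⟨hwalk, ⟨a', ha', hhead⟩, ⟨c, hc, hlast⟩⟩, hp⟩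
    obtain rfl : a' = a := ha'
    match p with
    | [] => simp at hhead
    | [y] =>
      simp only [List.head?_cons, Option.some.injEq] at hhead
      simp only [List.getLast?_singleton, Option.some.injEq] at hlast
      exact haB (hhead ▸ hlast ▸ hc)
    | y :: z :: l =>
      simp only [List.head?_cons, Option.some.injEq] at hhead
      subst hhead
      have hyz : (y, z) ∈ W.D := (List.isChain_cons_cons.1 hwalk).1
      have hzB : z ∈ W.B := (hbip.2 _ hyz).2
      refine haB (hp z (by simp) ⟨?_, hwave.1.b_out z hzB⟩ ▸ hzB)
      by_cases hz : z ∈ W.A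
      · exact Or.inl hz
      · have hzX : z ∈ carrierNbhd W X := ⟨y, haX, hyz, haB, hz⟩
        exact Or.inr (hne z hzX fun h => hbX (h ▸ hzX))
  refine ⟨X, fun x y => f (x, y), fun x y => NNReal.coe_nonneg _,
    fun x y hxy => hsupp x y (by exact_mod_cast hxy), fun x => ?_,
    fun y hy hyb => hasSum_coe_real_of_tsum_eq (hne y hy hyb), ?_⟩
  · lift dplus f x to ℝ≥0 using ((hrow x).trans_lt ENNReal.coe_lt_top).ne with r hr
    have hsum : HasSum (fun y => (f (x, y) : ℝ)) r := hasSum_coe_real_of_tsum_eq hr.symm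
    refine ⟨hsum.summable, hsum.tsum_eq.trans_le ?_⟩
    exact_mod_cast hr ▸ hrow x
  · rw [← NNReal.coe_sub hε]
    refine hasSum_coe_real_of_tsum_eq ?_
    simpa [dminus] using hcol b hbX

theorem exists_isDeficientWave_zero {W : Web V} {b : V}
    (h : ∀ ε : ℝ≥0, 0 < ε → ε ≤ W.w b → ∃ X p, IsDeficientWave W b ε X p) (hw : 0 < W.w b) :
    ∃ X p, IsDeficientWave W b 0 X p := by
  have hpos : ∀ n : ℕ, (0 : ℝ) < W.w b / 2 ^ n := fun n =>
    div_pos (NNReal.coe_pos.2 hw) (by positivity)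
  have hstep : ∀ n (s : {s : Set V × (V → V → ℝ) // IsDeficientWave W b (W.w b / 2 ^ n) s.1 s.2}),
      ∃ s' : {s : Set V × (V → V → ℝ) // IsDeficientWave W b (W.w b / 2 ^ (n + 1)) s.1 s.2},
        s.1.1 ⊆ s'.1.1 ∧
        (∀ x ∈ s.1.1, ∀ t : Finset V, ∑ y ∈ t, |s'.1.2 x y - s.1.2 x y| ≤
          3 * (W.w b / 2 ^ n - W.w b / 2 ^ (n + 1))) ∧
        (∀ y ∈ insert b (carrierNbhd W s.1.1), ∀ t : Finset V,
          ∑ x ∈ t, |s'.1.2 x y - s.1.2 x y| ≤ 3 * (W.w b / 2 ^ n - W.w b / 2 ^ (n + 1))) := by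
    rintro n ⟨⟨X, p⟩, hp⟩
    obtain ⟨X', f, hf⟩ := h (W.w b / 2 ^ (n + 1)) (div_pos hw (by positivity))
      (div_le_self zero_le (one_le_pow₀ one_le_two))
    push_cast at hf
    obtain ⟨p', hp', hr, hc⟩ := hp.exists_improvement hf
      (div_lt_div_of_pos_left (NNReal.coe_pos.2 hw) (by positivity)
        (pow_lt_pow_right₀ one_lt_two n.lt_succ_self))
    exact ⟨⟨(X ∪ X', p'), hp'⟩, Set.subset_union_left, hr, hc⟩
  choose next hsub hr hc using hstep
  have hzero : IsDeficientWave W b (W.w b / 2 ^ 0) ∅ fun _ _ => 0 :=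
    { nonneg := fun _ _ => le_rfl
      supp := fun _ _ hne => absurd rfl hne
      row := fun x => ⟨summable_zero, by simp⟩
      col := fun _ hy _ => absurd hy (by simp [carrierNbhd])
      col_root := by simp }
  let s : ∀ n, {s : Set V × (V → V → ℝ) // IsDeficientWave W b (W.w b / 2 ^ n) s.1 s.2} :=
    fun n => Nat.rec ⟨(∅, fun _ _ => 0), hzero⟩ next n
  obtain ⟨q, hq⟩ := IsDeficientWave.exists_limit (fun n => (s n).2)
    (monotone_nat_of_le_succ fun n => hsub n (s n)) (fun n => (hpos n).le)
    (tendsto_const_nhds.div_atTop (tendsto_pow_atTop_atTop_of_one_lt one_lt_two))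
    (fun n => hr n (s n)) (fun n => hc n (s n))
  exact ⟨_, q, hq⟩

theorem IsDeficientWave.not_loose {W : Web V} (hbip : Bipartite W) {b : V} {X : Set V}
    {q : V → V → ℝ} (hq : IsDeficientWave W b 0 X q) (hw : 0 < W.w b) : ¬ Loose W := by
  intro hloose
  have hcol : ∀ y (r : ℝ≥0), HasSum (fun x => q x y) r →
      dminus (fun e => (q e.1 e.2).toNNReal) y = r := fun y r hr => by
    have : HasSum (fun x => (q x y).toNNReal) r := by
      rw [← NNReal.hasSum_coe]
      simpa only [Real.coe_toNNReal _ (hq.nonneg _ y)] using hr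
    exact (ENNReal.hasSum_coe.2 this).tsum_eq
  have hroot : HasSum (fun x => q x b) (W.w b) := by simpa using hq.col_root
  have hwave : IsWave W fun e => (q e.1 e.2).toNNReal := by
    refine isWave_of_saturated hbip (X := X) (fun x y hxy => hq.supp x y fun h => hxy (by simp [h]))
      (fun x => ?_) fun y hy => ?_
    · have hx : ∑' y, ENNReal.ofReal (q x y) = ENNReal.ofReal (∑' y, q x y) :=
        (ENNReal.ofReal_tsum_of_nonneg (hq.nonneg x) (hq.row x).1).symm
      refine hx.trans_le ?_
      rw [← ENNReal.ofReal_coe_nnreal]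
      exact ENNReal.ofReal_le_ofReal (hq.row x).2
    · by_cases hyb : y = b
      · exact hyb ▸ hcol b _ hroot
      · exact hcol y _ (hq.col y hy hyb)
  have hb := hcol b _ hroot
  have h0 : (fun e : V × V => (q e.1 e.2).toNNReal) = fun _ => 0 := funext (hloose.1 _ hwave)
  rw [h0] at hb
  simp only [dminus, ENNReal.coe_zero, tsum_zero] at hb
  exact hw.ne (by exact_mod_cast hb)

theorem stmt13 [Countable V] (W : Web V) (hbip : Bipartite W) (hloose : Loose W)
    (b : V) (hb : b ∈ W.B) (hw : 0 < W.w b) :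
    ∃ ε : ℝ≥0, 0 < ε ∧ ε ≤ W.w b ∧
      ¬ Hindered {W with w := fun v => if v = b then W.w v - ε else W.w v} := by
  by_contra! hcon
  obtain ⟨X, q, hq⟩ := exists_isDeficientWave_zero
    (fun ε hε hle => (hcon ε hε hle).exists_isDeficientWave hbip hloose hle) hw
  exact hq.not_loose hbip hw hloose
end

section
/- There exists a locally finite countable network in which no mundane flow attains the supremum τ_m of the values of mundane flows (even though τ_m = σ, the minimum cut capacity, equals 1 and mundane flows of value 1 − 2^{−k} exist for all k). -/
open scoped ENNReal NNReal Classical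

variable {V : Type}

/-! ### Paths, cuts and mundane flows -/

/-- The consecutive pairs of a list of vertices. -/
def pathEdges (p : List V) : List (V × V) := p.zip p.tail

lemma pathEdges_cons_cons (a b : V) (p : List V) :
    pathEdges (a :: b :: p) = (a, b) :: pathEdges (b :: p) := rfl

lemma mem_of_mem_pathEdges {p : List V} {e : V × V} (h : e ∈ pathEdges p) :
    e.1 ∈ p ∧ e.2 ∈ p :=
  ⟨(List.of_mem_zip h).1, List.mem_of_mem_tail (List.of_mem_zip h).2⟩

lemma not_mem_pathEdges_of_tail {a x v : V} {p : List V} (h : x ∉ p) :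
    (v, x) ∉ pathEdges (a :: p) := fun h' => h (List.of_mem_zip h').2

lemma mem_pathEdges_append {p q : List V} {e : V × V} (h : e ∈ pathEdges (p ++ q)) :
    e ∈ pathEdges p ∨ e ∈ pathEdges q ∨ (e.1 ∈ p ∧ e.2 ∈ q) := by
  induction p with
  | nil => exact Or.inr (Or.inl h)
  | cons a p ih =>
    cases p with
    | nil =>
      cases q with
      | nil => simp [pathEdges] at h
      | cons b q =>
        rw [List.cons_append, List.nil_append, pathEdges_cons_cons, List.mem_cons] at h
        rcases h with rfl | h
        · simp
        · exact Or.inr (Or.inl h)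
    | cons b p =>
      rw [List.cons_append, List.cons_append, pathEdges_cons_cons, List.mem_cons] at h
      rw [pathEdges_cons_cons]
      rcases h with rfl | h
      · simp
      · rcases ih h with h | h | h
        · exact Or.inl (List.mem_cons_of_mem _ h)
        · exact Or.inr (Or.inl h)
        · exact Or.inr (Or.inr ⟨List.mem_cons_of_mem _ h.1, h.2⟩)

lemma pathEdges_map {W : Type} (g : V → W) (p : List V) :
    pathEdges (p.map g) = (pathEdges p).map (Prod.map g g) := by
  rw [pathEdges, pathEdges, ← List.map_tail, List.zip_map]

lemma pathEdges_subset_append_left (p q : List V) : pathEdges p ⊆ pathEdges (p ++ q) := by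
  induction p with
  | nil => simp [pathEdges]
  | cons a p ih =>
    cases p with
    | nil => simp [pathEdges]
    | cons b p =>
      rw [List.cons_append, List.cons_append, pathEdges_cons_cons, pathEdges_cons_cons]
      exact List.cons_subset_cons _ ih

lemma pathEdges_subset_cons (a : V) (p : List V) : pathEdges p ⊆ pathEdges (a :: p) := by
  cases p with
  | nil => simp [pathEdges]
  | cons b p => exact List.subset_cons_self _ _

lemma pathEdges_subset_append_right (p q : List V) : pathEdges q ⊆ pathEdges (p ++ q) := by
  induction p with
  | nil => exact List.Subset.refl _
  | cons a p ih => exact List.Subset.trans ih (pathEdges_subset_cons a _)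

lemma IsWalk.mem_of_mem_pathEdges {E : Set (V × V)} {p : List V} (hp : IsWalk E p)
    {e : V × V} (he : e ∈ pathEdges p) : e ∈ E := by
  induction p with
  | nil => simp [pathEdges] at he
  | cons a p ih =>
    cases p with
    | nil => simp [pathEdges] at he
    | cons b p =>
      replace hp := List.isChain_cons_cons.1 hp
      rw [pathEdges_cons_cons, List.mem_cons] at he
      rcases he with rfl | he
      · exact hp.1
      · exact ih hp.2 he

lemma exists_crossing {S : Set V} {p : List V} {a b : V} (ha : p.head? = some a)
    (hb : p.getLast? = some b) (haS : a ∈ S) (hbS : b ∉ S) :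
    ∃ e ∈ pathEdges p, e.1 ∈ S ∧ e.2 ∉ S := by
  induction p generalizing a with
  | nil => simp at ha
  | cons x p ih =>
    obtain rfl : x = a := by simpa using ha
    cases p with
    | nil =>
      obtain rfl : x = b := by simpa using hb
      exact absurd haS hbS
    | cons y p =>
      by_cases hy : y ∈ S
      · obtain ⟨e, he, h⟩ := ih (a := y) rfl (by simpa using hb) hy
        exact ⟨e, pathEdges_subset_cons _ _ he, h⟩
      · exact ⟨(x, y), by simp [pathEdges_cons_cons], haS, hy⟩

lemma exists_append_of_mem_pathEdges {p : List V} {e : V × V} (he : e ∈ pathEdges p) :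
    ∃ q r, p = q ++ r ∧ q.getLast? = some e.1 ∧ r.head? = some e.2 := by
  induction p with
  | nil => simp [pathEdges] at he
  | cons a p ih =>
    cases p with
    | nil => simp [pathEdges] at he
    | cons b p =>
      rw [pathEdges_cons_cons, List.mem_cons] at he
      rcases he with rfl | he
      · exact ⟨[a], b :: p, rfl, rfl, rfl⟩
      · obtain ⟨q, r, h, hq, hr⟩ := ih he
        refine ⟨a :: q, r, by rw [h]; rfl, ?_, hr⟩
        cases q with
        | nil => simp at hq
        | cons c q => simpa using hq

/-- The characteristic function of the edge set of a path. -/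
noncomputable def pathInd (p : List V) (e : V × V) : ℝ≥0∞ := if e ∈ pathEdges p then 1 else 0

lemma pathInd_cons_cons_self (a b : V) (p : List V) : pathInd (a :: b :: p) (a, b) = 1 := by
  simp [pathInd, pathEdges_cons_cons]

lemma pathInd_cons_cons_of_ne {a b : V} {e : V × V} (h : e ≠ (a, b)) (p : List V) :
    pathInd (a :: b :: p) e = pathInd (b :: p) e := by
  simp [pathInd, pathEdges_cons_cons, h]

lemma tsum_pathInd_out {p : List V} (hp : p.Nodup) (x : V) :
    ∑' v, pathInd p (x, v) = if x ∈ p ∧ p.getLast? ≠ some x then 1 else 0 := by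
  induction p with
  | nil => simp [pathInd, pathEdges]
  | cons a p ih =>
    cases p with
    | nil =>
      simp +contextual [pathInd, pathEdges]
    | cons b p =>
      by_cases hx : x = a
      · subst hx
        have hxp : x ∉ b :: p := (List.nodup_cons.1 hp).1
        have hl : (x :: b :: p).getLast? ≠ some x := by
          rw [List.getLast?_cons_cons]
          exact fun h => hxp (List.mem_of_getLast? h)
        rw [if_pos ⟨by simp, hl⟩, tsum_eq_single b, pathInd_cons_cons_self]
        intro v hv
        rw [pathInd_cons_cons_of_ne (by simpa using hv), pathInd,
          if_neg fun h => hxp (mem_of_mem_pathEdges h).1]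
      · have : ∀ v, pathInd (a :: b :: p) (x, v) = pathInd (b :: p) (x, v) := fun v =>
          pathInd_cons_cons_of_ne (by simp [hx]) _
        simp_rw [this]
        rw [ih (List.nodup_cons.1 hp).2, List.getLast?_cons_cons]
        simp [hx]

lemma tsum_pathInd_in {p : List V} (hp : p.Nodup) (x : V) :
    ∑' v, pathInd p (v, x) = if x ∈ p ∧ p.head? ≠ some x then 1 else 0 := by
  induction p with
  | nil => simp [pathInd, pathEdges]
  | cons a p ih =>
    cases p with
    | nil =>
      have : ¬ (x = a ∧ ¬ a = x) := fun h => h.2 h.1.symm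
      simp [pathInd, pathEdges, this]
    | cons b p =>
      have hab : a ∉ b :: p := (List.nodup_cons.1 hp).1
      have hbp : b ∉ p := (List.nodup_cons.1 (List.nodup_cons.1 hp).2).1
      by_cases hx : x = b
      · subst hx
        have : a ≠ x := fun h => hab (by simp [h])
        rw [if_pos ⟨by simp, by simpa using this⟩, tsum_eq_single a, pathInd_cons_cons_self]
        intro v hv
        rw [pathInd_cons_cons_of_ne (by simpa using hv), pathInd,
          if_neg (not_mem_pathEdges_of_tail hbp)]
      · have : ∀ v, pathInd (a :: b :: p) (v, x) = pathInd (b :: p) (v, x) := fun v =>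
          pathInd_cons_cons_of_ne (by simp [hx]) _
        simp_rw [this]
        rw [ih (List.nodup_cons.1 hp).2]
        congr 1
        by_cases hxa : x = a
        · subst hxa
          simp [hab]
        · simp [hx, hxa, Ne.symm hxa, Ne.symm hx]

lemma isMundane_iff {N : Network V} {f : V × V → ℝ≥0} :
    IsMundane N f ↔ ∃ (ι : Type) (θ : ι → ℝ≥0) (P : ι → List V),
      (∀ i, 0 < θ i) ∧ (∀ i, IsSTPath N (P i)) ∧
      ∀ e : V × V, (f e : ℝ≥0∞) = ∑' i, θ i * pathInd (P i) e := by
  have : ∀ (p : List V) (e : V × V) (r : ℝ≥0∞),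
      r * pathInd p e = if e ∈ p.zip p.tail then r else 0 := fun p e r => by
    rw [pathInd, pathEdges]
    split_ifs <;> simp
  simp only [IsMundane, this]

section PathFamily

variable {N : Network V} {ι : Type} {θ : ι → ℝ≥0} {P : ι → List V} {f : V × V → ℝ≥0}

lemma dplus_of_paths (hP : ∀ i, IsSTPath N (P i))
    (hf : ∀ e : V × V, (f e : ℝ≥0∞) = ∑' i, θ i * pathInd (P i) e) (x : V) :
    dplus f x = ∑' i, (θ i : ℝ≥0∞) * if x ∈ P i ∧ x ≠ N.t then 1 else 0 := by
  simp_rw [dplus, hf]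
  rw [ENNReal.tsum_comm]
  refine tsum_congr fun i => ?_
  rw [ENNReal.tsum_mul_left, tsum_pathInd_out (hP i).2.2.2, (hP i).2.2.1]
  simp [eq_comm]

lemma dminus_of_paths (hP : ∀ i, IsSTPath N (P i))
    (hf : ∀ e : V × V, (f e : ℝ≥0∞) = ∑' i, θ i * pathInd (P i) e) (x : V) :
    dminus f x = ∑' i, (θ i : ℝ≥0∞) * if x ∈ P i ∧ x ≠ N.s then 1 else 0 := by
  simp_rw [dminus, hf]
  rw [ENNReal.tsum_comm]
  refine tsum_congr fun i => ?_
  rw [ENNReal.tsum_mul_left, tsum_pathInd_in (hP i).2.2.2, (hP i).2.1]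
  simp [eq_comm]

lemma isFlow_of_paths (hP : ∀ i, IsSTPath N (P i))
    (hf : ∀ e : V × V, (f e : ℝ≥0∞) = ∑' i, θ i * pathInd (P i) e)
    (hc : ∀ e ∈ N.E, f e ≤ N.c e) : IsFlow N f := by
  have supp : ∀ e, e ∉ N.E → f e = 0 := fun e he => by
    have : ∀ i, (θ i : ℝ≥0∞) * pathInd (P i) e = 0 := fun i => by
      rw [pathInd, if_neg fun h => he ((hP i).1.mem_of_mem_pathEdges h), mul_zero]
    have h := hf e
    simp_rw [this, tsum_zero] at h
    exact_mod_cast h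
  refine ⟨supp, fun e => ?_, fun x hs ht => ?_⟩
  · by_cases he : e ∈ N.E
    · exact hc e he
    · simp [supp e he]
  · rw [dplus_of_paths hP hf, dminus_of_paths hP hf]
    simp [hs, ht]

lemma flowValue_of_paths (hP : ∀ i, IsSTPath N (P i))
    (hf : ∀ e : V × V, (f e : ℝ≥0∞) = ∑' i, θ i * pathInd (P i) e) :
    flowValue N f = ∑' i, (θ i : ℝ≥0∞) := by
  rw [flowValue, dplus_of_paths hP hf]
  refine tsum_congr fun i => ?_
  rw [if_pos ⟨List.mem_of_head? (hP i).2.1, N.ne⟩, mul_one]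

lemma tsum_paths_crossing_le (hc : ∀ e, f e ≤ N.c e)
    (hf : ∀ e : V × V, (f e : ℝ≥0∞) = ∑' i, θ i * pathInd (P i) e) (S : Set V) :
    ∑' i, (θ i : ℝ≥0∞) * ∑' e : cutEdges N S, pathInd (P i) e ≤ cutCap N S := by
  simp_rw [← ENNReal.tsum_mul_left]
  rw [ENNReal.tsum_comm]
  refine ENNReal.tsum_le_tsum fun e => ?_
  rw [← hf]
  exact_mod_cast hc e

end PathFamily

lemma one_le_crossings {N : Network V} {S : Set V} (hS : IsCut N S) {p : List V}
    (hp : IsSTPath N p) : 1 ≤ ∑' e : cutEdges N S, pathInd p e := by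
  obtain ⟨e, he, h⟩ := exists_crossing hp.2.1 hp.2.2.1 hS.1 hS.2
  refine le_trans ?_ (ENNReal.le_tsum ⟨e, hp.1.mem_of_mem_pathEdges he, h⟩)
  simp [pathInd, he]

lemma two_le_crossings {N : Network V} {S : Set V} (hS : IsCut N S) {p : List V}
    (hp : IsSTPath N p) {e : V × V} (he : e ∈ pathEdges p) (h1 : e.1 ∉ S) (h2 : e.2 ∈ S) :
    2 ≤ ∑' e : cutEdges N S, pathInd p e := by
  obtain ⟨hw, hh, hl, hn⟩ := hp
  obtain ⟨q, r, rfl, hq, hr⟩ := exists_append_of_mem_pathEdges he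
  have hq0 : q ≠ [] := by rintro rfl; simp at hq
  have hr0 : r ≠ [] := by rintro rfl; simp at hr
  rw [List.head?_append_of_ne_nil _ hq0] at hh
  rw [List.getLast?_append_of_ne_nil _ hr0] at hl
  obtain ⟨e₁, he₁, h₁⟩ := exists_crossing hh hq hS.1 h1
  obtain ⟨e₂, he₂, h₂⟩ := exists_crossing hr hl h2 hS.2
  have hne : e₁ ≠ e₂ := by
    rintro rfl
    exact List.disjoint_of_nodup_append hn (mem_of_mem_pathEdges he₁).1
      (mem_of_mem_pathEdges he₂).1
  have he₁' := pathEdges_subset_append_left q r he₁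
  have he₂' := pathEdges_subset_append_right q r he₂
  let a : cutEdges N S := ⟨e₁, hw.mem_of_mem_pathEdges he₁', h₁⟩
  let b : cutEdges N S := ⟨e₂, hw.mem_of_mem_pathEdges he₂', h₂⟩
  have hab : a ≠ b := fun h => hne (congrArg Subtype.val h)
  refine le_trans ?_ (ENNReal.sum_le_tsum {a, b})
  rw [Finset.sum_pair hab]
  simp [pathInd, a, b, he₁', he₂', one_add_one_eq_two]

lemma flowValue_le_cutCap {N : Network V} {f : V × V → ℝ≥0} (hf : IsFlow N f)
    (hm : IsMundane N f) {S : Set V} (hS : IsCut N S) : flowValue N f ≤ cutCap N S := by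
  obtain ⟨ι, θ, P, -, hP, h⟩ := isMundane_iff.1 hm
  rw [flowValue_of_paths hP h]
  refine le_trans (ENNReal.tsum_le_tsum fun i => ?_) (tsum_paths_crossing_le hf.cap h S)
  exact le_mul_of_one_le_right' (one_le_crossings hS (hP i))

/-- If every `s`–`t` path crosses back some cut of capacity at most `r`, then no mundane flow
has value `r`. -/
lemma flowValue_ne_of_back_crossing {N : Network V} {r : ℝ≥0∞} (hr0 : r ≠ 0) (hr : r ≠ ⊤)
    (hN : ∀ p, IsSTPath N p → ∃ S, IsCut N S ∧ cutCap N S ≤ r ∧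
      ∃ e ∈ pathEdges p, e.1 ∉ S ∧ e.2 ∈ S)
    {f : V × V → ℝ≥0} (hf : IsFlow N f) (hm : IsMundane N f) : flowValue N f ≠ r := by
  obtain ⟨ι, θ, P, hθ, hP, h⟩ := isMundane_iff.1 hm
  rw [flowValue_of_paths hP h]
  intro hv
  cases isEmpty_or_nonempty ι with
  | inl _ => simp at hv; exact hr0 hv.symm
  | inr hι =>
    obtain ⟨i₀⟩ := hι
    obtain ⟨S, hS, hcap, e, he, h1, h2⟩ := hN _ (hP i₀)
    have key : ∑' i, ((θ i : ℝ≥0∞) + if i = i₀ then (θ i₀ : ℝ≥0∞) else 0) ≤ r := by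
      refine le_trans (ENNReal.tsum_le_tsum fun i => ?_)
        ((tsum_paths_crossing_le hf.cap h S).trans hcap)
      split_ifs with hi
      · subst hi
        rw [← mul_two]
        exact mul_le_mul_right (two_le_crossings hS (hP i) he h1 h2) _
      · rw [add_zero]
        exact le_mul_of_one_le_right' (one_le_crossings hS (hP i))
    rw [ENNReal.tsum_add, hv, tsum_ite_eq] at key
    have : (0 : ℝ≥0∞) < θ i₀ := by exact_mod_cast hθ i₀
    exact absurd key (not_le.2 (ENNReal.lt_add_right hr this.ne'))

lemma cutCap_le_sum {N : Network V} {S : Set V} {L : List (V × V)}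
    (h : ∀ e ∈ cutEdges N S, e ∈ L) : cutCap N S ≤ (L.map fun e => (N.c e : ℝ≥0∞)).sum := by
  have key : ∀ L : List (V × V), ∑' e : {e | e ∈ L}, (N.c e : ℝ≥0∞) ≤
      (L.map fun e => (N.c e : ℝ≥0∞)).sum := fun L => by
    induction L with
    | nil => simp
    | cons a L ih =>
      have : {e | e ∈ a :: L} = {a} ∪ {e | e ∈ L} := by ext; simp
      rw [this, List.map_cons, List.sum_cons]
      refine (ENNReal.tsum_union_le (fun e => (N.c e : ℝ≥0∞)) _ _).trans ?_
      rw [tsum_singleton a (fun e => (N.c e : ℝ≥0∞))]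
      gcongr
  exact (ENNReal.tsum_mono_subtype (fun e => (N.c e : ℝ≥0∞)) h).trans (key L)

/-! ### The binary tree network -/

/-- The edges between the vertices `(l, i)` and `(l', j)` of the tree network, where `(l, i)` is
the `i`-th vertex on the path at the node `l` of the binary tree. -/
inductive TreeArc : List Bool → Fin 4 → List Bool → Fin 4 → Prop
  | first : TreeArc [] 0 [] 1
  | middle : TreeArc [] 1 [] 2
  | last : TreeArc [] 2 [] 3
  | enter_false : TreeArc [] 0 [false] 0
  | leave_false : TreeArc [false] 3 [] 2
  | enter_true : TreeArc [] 1 [true] 0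
  | leave_true : TreeArc [true] 3 [] 3
  | lift (b : Bool) {l l' : List Bool} {i j : Fin 4} (h : TreeArc l i l' j) :
      TreeArc (b :: l) i (b :: l') j

/-- The capacity of an edge of the tree network, depending only on its depth. -/
noncomputable def treeCap (e : (List Bool × Fin 4) × (List Bool × Fin 4)) : ℝ≥0 :=
  2⁻¹ ^ (min e.1.1.length e.2.1.length + 1)

lemma TreeArc.ne {l l' : List Bool} {i j : Fin 4} (h : TreeArc l i l' j) :
    (l, i) ≠ (l', j) := by
  induction h <;> simp_all

lemma TreeArc.length_le {l l' : List Bool} {i j : Fin 4} (h : TreeArc l i l' j) :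
    l.length ≤ l'.length + 1 ∧ l'.length ≤ l.length + 1 := by
  induction h <;> simp_all

lemma TreeArc.not_to_source {l : List Bool} {i : Fin 4} : ¬ TreeArc l i [] 0 := nofun

lemma TreeArc.not_from_sink {l : List Bool} {i : Fin 4} : ¬ TreeArc [] 3 l i := nofun

/-- The tree network. -/
noncomputable def treeNetwork : Network (List Bool × Fin 4) where
  E := {e | TreeArc e.1.1 e.1.2 e.2.1 e.2.2}
  loopless := fun _ h => TreeArc.ne h rfl
  c := treeCap
  s := ([], 0)
  t := ([], 3)
  ne := by simp
  no_in_s := fun _ h => TreeArc.not_to_source h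
  no_out_t := fun _ h => TreeArc.not_from_sink h

lemma mem_treeNetwork {e : (List Bool × Fin 4) × (List Bool × Fin 4)} :
    e ∈ treeNetwork.E ↔ TreeArc e.1.1 e.1.2 e.2.1 e.2.2 := Iff.rfl

lemma treeNetwork_locallyFinite : NetLocallyFinite treeNetwork := fun v => by
  have hB : {u : List Bool × Fin 4 | u.1.length ≤ v.1.length + 1}.Finite :=
    ((List.finite_length_le Bool (v.1.length + 1)).prod (Set.finite_univ (α := Fin 4))).subset
      fun u hu => ⟨hu, trivial⟩
  refine (hB.prod hB).subset ?_
  rintro ⟨a, b⟩ ⟨h, h'⟩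
  have := TreeArc.length_le h
  simp only [Set.mem_prod, Set.mem_ofPred_eq] at this h' ⊢
  rcases h' with rfl | rfl <;> omega

/-! Minimum cuts of the tree network. -/

/-- The source side of the minimum cut crossed backwards by the middle edge at the node `m`. -/
def TreeSide : List Bool → List Bool → Fin 4 → Prop
  | [], [], j => j = 0 ∨ j = 2
  | [], b :: _, _ => b = false
  | b :: _, [], j => j = 0 ∨ (b = true ∧ j ≠ 3)
  | b :: m, b' :: l, j => (b' = b ∧ TreeSide m l j) ∨ (b' ≠ b ∧ b' = false)

/-- The edges of the cut given by `TreeSide m`. -/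
def treeCut : List Bool → List ((List Bool × Fin 4) × (List Bool × Fin 4))
  | [] => [(([], 0), ([], 1)), (([], 2), ([], 3))]
  | b :: m => (if b then (([], 2), ([], 3)) else (([], 0), ([], 1))) ::
      (treeCut m).map fun e => ((b :: e.1.1, e.1.2), (b :: e.2.1, e.2.2))

lemma treeSide_source (m : List Bool) : TreeSide m [] 0 := by
  cases m <;> simp [TreeSide]

lemma not_treeSide_sink (m : List Bool) : ¬ TreeSide m [] 3 := by
  cases m <;> simp [TreeSide]

lemma not_treeSide_middle_fst (m : List Bool) : ¬ TreeSide m m 1 := by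
  induction m <;> simp_all [TreeSide]

lemma treeSide_middle_snd (m : List Bool) : TreeSide m m 2 := by
  induction m <;> simp_all [TreeSide]

lemma TreeArc.mem_treeCut {l l' : List Bool} {i j : Fin 4} (h : TreeArc l i l' j)
    {m : List Bool} (hl : TreeSide m l i) (hl' : ¬ TreeSide m l' j) :
    ((l, i), (l', j)) ∈ treeCut m := by
  induction h generalizing m with
  | lift b h ih =>
    cases m with
    | nil => simp_all [TreeSide]
    | cons b' m =>
      by_cases hb : b = b'
      · subst hb
        simp only [TreeSide, true_and, ne_eq, not_true_eq_false, false_and, or_false] at hl hl'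
        exact List.mem_cons_of_mem _ (List.mem_map.2 ⟨_, ih hl hl', rfl⟩)
      · simp_all [TreeSide]
  | _ =>
    rcases m with _ | ⟨_ | _, m⟩ <;>
      simp_all [TreeSide, treeCut, treeSide_source, not_treeSide_sink]

lemma sum_treeCut (m : List Bool) :
    ((treeCut m).map fun e => (treeCap e : ℝ≥0∞)).sum = 1 := by
  have h2 : ((2⁻¹ : ℝ≥0) : ℝ≥0∞) = 2⁻¹ := by simp
  induction m with
  | nil => simp [treeCut, treeCap, ENNReal.inv_two_add_inv_two]
  | cons b m ih =>
    have hr : treeCap (if b then (([], 2), ([], 3)) else (([], 0), ([], 1))) = 2⁻¹ := by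
      cases b <;> simp [treeCap]
    have hl : ∀ e : (List Bool × Fin 4) × (List Bool × Fin 4),
        (treeCap ((b :: e.1.1, e.1.2), (b :: e.2.1, e.2.2)) : ℝ≥0∞) = 2⁻¹ * treeCap e :=
      fun e => by
        rw [← h2, ← ENNReal.coe_mul, treeCap, treeCap, ← pow_succ', List.length_cons,
          List.length_cons, Nat.add_min_add_right]
    rw [treeCut, List.map_cons, List.sum_cons, List.map_map, hr, h2]
    simp only [Function.comp_def, hl]
    rw [List.sum_map_mul_left, ih, mul_one, ENNReal.inv_two_add_inv_two]

lemma isCut_treeSide (m : List Bool) : IsCut treeNetwork {v | TreeSide m v.1 v.2} :=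
  ⟨treeSide_source m, not_treeSide_sink m⟩

lemma cutCap_treeSide_le (m : List Bool) :
    cutCap treeNetwork {v | TreeSide m v.1 v.2} ≤ 1 :=
  (cutCap_le_sum (N := treeNetwork) fun _ h =>
    TreeArc.mem_treeCut (mem_treeNetwork.1 h.1) h.2.1 h.2.2).trans (sum_treeCut m).le

lemma TreeArc.eq_middle {l l' : List Bool} {i j : Fin 4} (h : TreeArc l i l' j)
    (hi : i = 0 ∨ i = 1) (hj : ¬ (j = 0 ∨ j = 1)) : i = 1 ∧ j = 2 ∧ l = l' := by
  induction h <;> simp_all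

lemma exists_back_crossing (p : List (List Bool × Fin 4)) (hp : IsSTPath treeNetwork p) :
    ∃ S, IsCut treeNetwork S ∧ cutCap treeNetwork S ≤ 1 ∧
      ∃ e ∈ pathEdges p, e.1 ∉ S ∧ e.2 ∈ S := by
  obtain ⟨⟨⟨l, i⟩, ⟨l', j⟩⟩, he, h1, h2⟩ :=
    exists_crossing (S := {v | v.2 = 0 ∨ v.2 = 1}) hp.2.1 hp.2.2.1 (by simp [treeNetwork])
      (by simp [treeNetwork])
  have h : TreeArc l i l' j := hp.1.mem_of_mem_pathEdges he
  obtain ⟨rfl, rfl, rfl⟩ := h.eq_middle h1 h2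
  exact ⟨_, isCut_treeSide l, cutCap_treeSide_le l, _, he, not_treeSide_middle_fst l,
    treeSide_middle_snd l⟩

/-! Mundane flows in the tree network. -/

/-- The copy of a vertex in the subtree at the child `b` of the root. -/
def liftVertex (b : Bool) (v : List Bool × Fin 4) : List Bool × Fin 4 := (b :: v.1, v.2)

lemma liftVertex_injective (b : Bool) : Function.Injective (liftVertex b) := fun u v h => by
  simpa [liftVertex, Prod.ext_iff] using h

/-- The path obtained by detouring through the subtree at `false`. -/
def falsePath (p : List (List Bool × Fin 4)) : List (List Bool × Fin 4) :=
  [([], 0)] ++ (p.map (liftVertex false) ++ [([], 2), ([], 3)])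

/-- The path obtained by detouring through the subtree at `true`. -/
def truePath (p : List (List Bool × Fin 4)) : List (List Bool × Fin 4) :=
  [([], 0), ([], 1)] ++ (p.map (liftVertex true) ++ [([], 3)])

/-- The path along the root. -/
def rootPath : List (List Bool × Fin 4) := [([], 0), ([], 1), ([], 2), ([], 3)]

lemma isSTPath_rootPath : IsSTPath treeNetwork rootPath := by
  refine ⟨List.isChain_cons_cons.2 ⟨.first, ?_⟩, rfl, rfl, by simp [rootPath]⟩
  exact List.isChain_cons_cons.2 ⟨.middle, List.isChain_pair.2 .last⟩

lemma isWalk_map_liftVertex (b : Bool) {p : List (List Bool × Fin 4)}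
    (hp : IsWalk treeNetwork.E p) : IsWalk treeNetwork.E (p.map (liftVertex b)) :=
  List.isChain_map_of_isChain (liftVertex b) (fun _ _ h => TreeArc.lift b h) hp

lemma isSTPath_falsePath {p : List (List Bool × Fin 4)} (hp : IsSTPath treeNetwork p) :
    IsSTPath treeNetwork (falsePath p) := by
  obtain ⟨hw, hh, hl, hn⟩ := hp
  refine ⟨?_, rfl, ?_, ?_⟩
  · refine List.isChain_append.2 ⟨List.isChain_singleton _, List.isChain_append.2
      ⟨isWalk_map_liftVertex false hw, ?_, ?_⟩, ?_⟩
    · simpa [mem_treeNetwork] using TreeArc.last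
    · simpa [hl, liftVertex, mem_treeNetwork, treeNetwork] using TreeArc.leave_false
    · simpa [hh, liftVertex, mem_treeNetwork, treeNetwork] using TreeArc.enter_false
  · rw [falsePath, ← List.append_assoc, List.getLast?_append_of_ne_nil _ (by simp)]
    rfl
  · have := hn.map (liftVertex_injective false)
    simp [falsePath, List.nodup_append, this, liftVertex]
    aesop

lemma isSTPath_truePath {p : List (List Bool × Fin 4)} (hp : IsSTPath treeNetwork p) :
    IsSTPath treeNetwork (truePath p) := by
  obtain ⟨hw, hh, hl, hn⟩ := hp
  refine ⟨?_, rfl, ?_, ?_⟩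
  · refine List.isChain_append.2 ⟨?_, List.isChain_append.2
      ⟨isWalk_map_liftVertex true hw, List.isChain_singleton _, ?_⟩, ?_⟩
    · simpa [mem_treeNetwork] using TreeArc.first
    · simpa [hl, liftVertex, mem_treeNetwork, treeNetwork] using TreeArc.leave_true
    · simpa [hh, liftVertex, mem_treeNetwork, treeNetwork] using TreeArc.enter_true
  · rw [truePath, ← List.append_assoc, List.getLast?_append_of_ne_nil _ (by simp)]
    rfl
  · have := hn.map (liftVertex_injective true)
    simp [truePath, List.nodup_append, this, liftVertex]
    aesop

/-- The paths through the nodes of depth less than `n`. -/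
def treePaths : ℕ → List (List (List Bool × Fin 4))
  | 0 => []
  | n + 1 => rootPath :: ((treePaths n).map falsePath ++ (treePaths n).map truePath)

lemma length_treePaths (n : ℕ) : (treePaths n).length + 1 = 2 ^ n := by
  induction n with
  | zero => rfl
  | succ n ih => simp [treePaths, pow_succ, ← ih]; ring

lemma isSTPath_of_mem_treePaths {n : ℕ} {p : List (List Bool × Fin 4)} (hp : p ∈ treePaths n) :
    IsSTPath treeNetwork p := by
  induction n generalizing p with
  | zero => simp [treePaths] at hp
  | succ n ih =>
    simp only [treePaths, List.mem_cons, List.mem_append, List.mem_map] at hp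
    rcases hp with rfl | ⟨q, hq, rfl⟩ | ⟨q, hq, rfl⟩
    · exact isSTPath_rootPath
    · exact isSTPath_falsePath (ih hq)
    · exact isSTPath_truePath (ih hq)

/-- The number of paths in `treePaths n` that use a given edge. -/
noncomputable def treeCount (n : ℕ) (e : (List Bool × Fin 4) × (List Bool × Fin 4)) : ℕ :=
  (treePaths n).countP fun p => e ∈ pathEdges p

lemma treeCount_succ (n : ℕ) (e : (List Bool × Fin 4) × (List Bool × Fin 4)) :
    treeCount (n + 1) e = (treePaths n).countP (fun p => e ∈ pathEdges (falsePath p)) +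
      (treePaths n).countP (fun p => e ∈ pathEdges (truePath p)) +
      if e ∈ pathEdges rootPath then 1 else 0 := by
  simp [treeCount, treePaths, List.countP_cons, List.countP_append, List.countP_map,
    Function.comp_def]

lemma treeCount_succ_le_of_root {e : (List Bool × Fin 4) × (List Bool × Fin 4)}
    (he : (∀ p, e ∉ pathEdges (falsePath p)) ∨ ∀ p, e ∉ pathEdges (truePath p)) (n : ℕ) :
    treeCount (n + 1) e ≤ 2 ^ n := by
  have h0 : (if e ∈ pathEdges rootPath then 1 else 0) ≤ 1 := by split_ifs <;> simp
  have hl := length_treePaths n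
  have h1 : (treePaths n).countP (fun p => e ∈ pathEdges (falsePath p)) ≤ _ :=
    List.countP_le_length
  have h2 : (treePaths n).countP (fun p => e ∈ pathEdges (truePath p)) ≤ _ :=
    List.countP_le_length
  rw [treeCount_succ]
  rcases he with he | he
  · have : (treePaths n).countP (fun p => e ∈ pathEdges (falsePath p)) = 0 := by simp [he]
    omega
  · have : (treePaths n).countP (fun p => e ∈ pathEdges (truePath p)) = 0 := by simp [he]
    omega

lemma mem_pathEdges_of_lift_false {b : Bool} {u v : List Bool × Fin 4}
    {p : List (List Bool × Fin 4)}
    (h : (liftVertex b u, liftVertex b v) ∈ pathEdges (falsePath p)) :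
    b = false ∧ (u, v) ∈ pathEdges p := by
  rcases mem_pathEdges_append h with h | h | h
  · simp [pathEdges] at h
  · rcases mem_pathEdges_append h with h | h | h
    · rw [pathEdges_map] at h
      simpa [liftVertex, Prod.ext_iff, and_comm, and_assoc, eq_comm] using h
    · simp [pathEdges, liftVertex] at h
    · simp [liftVertex] at h
  · simp [liftVertex] at h

lemma mem_pathEdges_of_lift_true {b : Bool} {u v : List Bool × Fin 4}
    {p : List (List Bool × Fin 4)}
    (h : (liftVertex b u, liftVertex b v) ∈ pathEdges (truePath p)) :
    b = true ∧ (u, v) ∈ pathEdges p := by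
  rcases mem_pathEdges_append h with h | h | h
  · simp [pathEdges, liftVertex] at h
  · rcases mem_pathEdges_append h with h | h | h
    · rw [pathEdges_map] at h
      simpa [liftVertex, Prod.ext_iff, and_comm, and_assoc, eq_comm] using h
    · simp [pathEdges] at h
    · simp [liftVertex] at h
  · simp [liftVertex] at h

lemma treeCount_succ_lift_le (n : ℕ) (b : Bool) (u v : List Bool × Fin 4) :
    treeCount (n + 1) (liftVertex b u, liftVertex b v) ≤ treeCount n (u, v) := by
  have h0 : (liftVertex b u, liftVertex b v) ∉ pathEdges rootPath := by
    simp [pathEdges, rootPath, liftVertex]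
  rw [treeCount_succ, if_neg h0, add_zero]
  cases b with
  | false =>
    rw [List.countP_eq_zero (p := fun p => _ ∈ pathEdges (truePath p)).2 fun p _ hp => by
      simpa using (mem_pathEdges_of_lift_true (of_decide_eq_true hp)).1, add_zero]
    exact List.countP_mono_left fun p _ hp =>
      decide_eq_true (mem_pathEdges_of_lift_false (of_decide_eq_true hp)).2
  | true =>
    rw [List.countP_eq_zero (p := fun p => _ ∈ pathEdges (falsePath p)).2 fun p _ hp => by
      simpa using (mem_pathEdges_of_lift_false (of_decide_eq_true hp)).1, zero_add]
    exact List.countP_mono_left fun p _ hp =>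
      decide_eq_true (mem_pathEdges_of_lift_true (of_decide_eq_true hp)).2

lemma TreeArc.treeCount_mul_le {l l' : List Bool} {i j : Fin 4} (h : TreeArc l i l' j) (n : ℕ) :
    treeCount n ((l, i), (l', j)) * 2 ^ (min l.length l'.length + 1) ≤ 2 ^ n := by
  induction n generalizing l l' i j with
  | zero => simp [treeCount, treePaths]
  | succ n ih =>
    rw [pow_succ, pow_succ, ← mul_assoc]
    refine Nat.mul_le_mul_right 2 ?_
    cases h with
    | lift b h =>
      refine le_trans ?_ (ih h)
      rw [List.length_cons, List.length_cons, Nat.add_min_add_right]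
      exact Nat.mul_le_mul_right _ (treeCount_succ_lift_le n b (_, _) (_, _))
    | last =>
      simpa using treeCount_succ_le_of_root (.inr fun p hp => by
        simpa [truePath, liftVertex] using mem_of_mem_pathEdges hp) n
    | enter_false =>
      simpa using treeCount_succ_le_of_root (.inr fun p hp => by
        simpa [truePath, liftVertex] using mem_of_mem_pathEdges hp) n
    | leave_false =>
      simpa using treeCount_succ_le_of_root (.inr fun p hp => by
        simpa [truePath, liftVertex] using mem_of_mem_pathEdges hp) n
    | _ =>
      simpa using treeCount_succ_le_of_root (.inl fun p hp => by
        simpa [falsePath, liftVertex] using mem_of_mem_pathEdges hp) n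

lemma exists_mundane_treeNetwork (k : ℕ) :
    ∃ f, IsFlow treeNetwork f ∧ IsMundane treeNetwork f ∧
      flowValue treeNetwork f = 1 - (2 ^ k : ℝ≥0∞)⁻¹ := by
  set θ : ℝ≥0 := (2 ^ k)⁻¹ with hθ
  have hθ' : (θ : ℝ≥0∞) = (2 ^ k)⁻¹ := by simp [hθ]
  have hP : ∀ i : Fin (treePaths k).length, IsSTPath treeNetwork (treePaths k)[i] := fun i =>
    isSTPath_of_mem_treePaths (List.getElem_mem _)
  have hcount : ∀ (L : List (List (List Bool × Fin 4))) e,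
      (L.map fun p => pathInd p e).sum = ((L.countP fun p => e ∈ pathEdges p : ℕ) : ℝ≥0∞) :=
    fun L e => by
      induction L with
      | nil => simp
      | cons p L ih =>
        rw [List.map_cons, List.sum_cons, ih, List.countP_cons, pathInd, add_comm]
        split_ifs <;> simp_all
  have hf : ∀ e, ((θ * treeCount k e : ℝ≥0) : ℝ≥0∞) =
      ∑' i : Fin (treePaths k).length, θ * pathInd (treePaths k)[i] e := fun e => by
    rw [ENNReal.tsum_mul_left, tsum_fintype,
      show ∑ i : Fin (treePaths k).length, pathInd (treePaths k)[i] e = _ from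
        Fin.sum_univ_fun_getElem (treePaths k) fun p => pathInd p e, hcount, treeCount]
    simp
  refine ⟨fun e => θ * treeCount k e, isFlow_of_paths hP hf fun e he => ?_,
    isMundane_iff.2 ⟨_, fun _ => θ, _, fun _ => by simp [hθ], hP, hf⟩, ?_⟩
  · have h : (treeCount k e * 2 ^ (min e.1.1.length e.2.1.length + 1) : ℝ≥0) ≤ 2 ^ k := by
      exact_mod_cast TreeArc.treeCount_mul_le he k
    change (2 ^ k)⁻¹ * _ ≤ (2⁻¹ : ℝ≥0) ^ _
    rwa [inv_pow, inv_mul_eq_div, ← one_div, div_le_div_iff₀ (by positivity) (by positivity),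
      one_mul]
  · rw [flowValue_of_paths hP hf]
    refine ENNReal.eq_sub_of_add_eq (by simp) ?_
    rw [tsum_fintype, Finset.sum_const, Finset.card_univ, Fintype.card_fin, nsmul_eq_mul, hθ',
      ← add_one_mul]
    have : ((treePaths k).length + 1 : ℝ≥0∞) = 2 ^ k := by exact_mod_cast length_treePaths k
    rw [this]
    exact ENNReal.mul_inv_cancel (by simp) (by simp)

lemma one_le_of_forall_one_sub_inv_two_pow_le {r : ℝ≥0∞}
    (h : ∀ k : ℕ, 1 - (2 ^ k : ℝ≥0∞)⁻¹ ≤ r) : 1 ≤ r := by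
  have h0 : Filter.Tendsto (fun k : ℕ => 1 - (2 ^ k : ℝ≥0∞)⁻¹) Filter.atTop
      (nhds (1 - 0)) := by
    refine ENNReal.Tendsto.sub tendsto_const_nhds ?_ (Or.inl ENNReal.one_ne_top)
    simp_rw [ENNReal.inv_pow]
    exact ENNReal.tendsto_pow_atTop_nhds_zero_of_lt_one (by simp)
  rw [tsub_zero] at h0
  exact le_of_tendsto' h0 h

theorem stmt19 :
    ∃ (V : Type) (_ : Countable V) (N : Network V), NetLocallyFinite N ∧
      (¬ ∃ f, (IsFlow N f ∧ IsMundane N f) ∧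
        flowValue N f = ⨆ (g : V × V → ℝ≥0) (_ : IsFlow N g ∧ IsMundane N g), flowValue N g) ∧
      (⨆ (g : V × V → ℝ≥0) (_ : IsFlow N g ∧ IsMundane N g), flowValue N g) = 1 ∧
      (⨅ (S : Set V) (_ : IsCut N S), cutCap N S) = 1 ∧
      ∀ k : ℕ, ∃ f, IsFlow N f ∧ IsMundane N f ∧
        flowValue N f = 1 - (2 ^ k : ℝ≥0∞)⁻¹ := by
  have hsup : (⨆ (g) (_ : IsFlow treeNetwork g ∧ IsMundane treeNetwork g),
      flowValue treeNetwork g) = 1 := by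
    refine le_antisymm (iSup₂_le fun g hg => ?_)
      (one_le_of_forall_one_sub_inv_two_pow_le fun k => ?_)
    · exact (flowValue_le_cutCap hg.1 hg.2 (isCut_treeSide [])).trans (cutCap_treeSide_le [])
    · obtain ⟨f, hf, hm, hv⟩ := exists_mundane_treeNetwork k
      exact hv ▸ le_iSup₂_of_le f ⟨hf, hm⟩ le_rfl
  refine ⟨List Bool × Fin 4, inferInstance, treeNetwork, treeNetwork_locallyFinite, ?_, hsup, ?_,
    exists_mundane_treeNetwork⟩
  · rw [hsup]
    rintro ⟨f, ⟨hf, hm⟩, hv⟩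
    exact flowValue_ne_of_back_crossing one_ne_zero ENNReal.one_ne_top exists_back_crossing
      hf hm hv
  · refine le_antisymm (iInf₂_le_of_le _ (isCut_treeSide []) (cutCap_treeSide_le []))
      (le_iInf₂ fun S hS => one_le_of_forall_one_sub_inv_two_pow_le fun k => ?_)
    obtain ⟨f, hf, hm, hv⟩ := exists_mundane_treeNetwork k
    exact hv ▸ flowValue_le_cutCap hf hm hS
end
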